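/- arXiv:2411.04391 — 6 statements merged into one kernel-verified Lean document; each statement's English description precedes it below -/
import Mathlib

section
/- Let (D_1, D_2, …) be the sequence of bins produced by FFD(M, v, τ). Then for every index i, D_i =_lex B_i, where B_i is the i-th benchmark bundle of the sequence (D_1, D_2, …) with respect to v and τ. -/
open Finset

variable {α : Type*} [DecidableEq α]

/-- The total cost of a bundle `S` of chores under the additive cost function `v`. -/
def bundleCost (v : α → ℚ) (S : Finset α) : ℚ := ∑ c ∈ S, v c

/-- `costSeq v B p` is the cost of the `p`-th most costly chore of `B` (0-indexed),
or `0` when `p ≥ |B|`. -/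
def costSeq (v : α → ℚ) (B : Finset α) (p : ℕ) : ℚ :=
  ((B.val.map v).sort (· ≤ ·)).reverse.getD p 0

/-- `B₁ =_lex B₂`. -/
def LexEq (v : α → ℚ) (B₁ B₂ : Finset α) : Prop :=
  ∀ p, costSeq v B₁ p = costSeq v B₂ p

/-- `B₁ ≤_lex B₂`. -/
def LexLe (v : α → ℚ) (B₁ B₂ : Finset α) : Prop :=
  LexEq v B₁ B₂ ∨ ∃ q, (∀ p < q, costSeq v B₁ p = costSeq v B₂ p) ∧
    costSeq v B₁ q < costSeq v B₂ q

/-- `B₁ ≥_lex B₂`. -/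
def LexGe (v : α → ℚ) (B₁ B₂ : Finset α) : Prop := LexLe v B₂ B₁

/-- Insert chore `c` into the first bin of the list whose cost stays at most `τ`;
open a new bin if it fits in no existing bin (and fits in an empty bin). -/
def ffdInsert (v : α → ℚ) (τ : ℚ) (c : α) : List (Finset α) → List (Finset α)
  | [] => if v c ≤ τ then [{c}] else []
  | B :: rest =>
      if bundleCost v B + v c ≤ τ then insert c B :: rest
      else B :: ffdInsert v τ c rest

/-- The list of bins produced by FFD with threshold `τ` on the list `L` of chores
(processed in the order of `L`). -/
def ffdBins (v : α → ℚ) (τ : ℚ) (L : List α) : List (Finset α) :=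
  L.foldl (fun bins c => ffdInsert v τ c bins) []

/-- `L` is a valid FFD processing order for `(M, v)`: an enumeration of `M`
in non-increasing order of cost. -/
def IsFFDList (v : α → ℚ) (M : Finset α) (L : List α) : Prop :=
  L.toFinset = M ∧ L.Nodup ∧ L.Pairwise fun c c' => v c' ≤ v c

/-- FFD allocates all the chores into (at most) `n` bins. -/
def FFDAllocatesInto (v : α → ℚ) (τ : ℚ) (L : List α) (n : ℕ) : Prop :=
  (ffdBins v τ L).length ≤ n ∧ ∀ c ∈ L, ∃ B ∈ ffdBins v τ L, c ∈ B

/-- The chores of `M` remaining after the first `k` bins of the list `D`. -/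
def remainingList (M : Finset α) (D : List (Finset α)) (k : ℕ) : Finset α :=
  M \ (D.take k).foldr (· ∪ ·) ∅

/-- `B` is a `k`-th benchmark bundle of the bin sequence `D` w.r.t. `M`, `v`, `τ`. -/
def IsBenchmarkList (M : Finset α) (D : List (Finset α)) (v : α → ℚ) (τ : ℚ)
    (k : ℕ) (B : Finset α) : Prop :=
  B ⊆ remainingList M D k ∧ bundleCost v B ≤ τ ∧
    ∀ B' ⊆ remainingList M D k, bundleCost v B' ≤ τ → LexGe v B B'

/-- The chores chosen greedily from the list with budget `r`. -/
def gsel (v : α → ℚ) : ℚ → List α → List α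
  | _, [] => []
  | r, c :: L => if v c ≤ r then c :: gsel v (r - v c) L else gsel v r L

/-- The chores left over by the greedy choice. -/
def gleft (v : α → ℚ) : ℚ → List α → List α
  | _, [] => []
  | r, c :: L => if v c ≤ r then gleft v (r - v c) L else c :: gleft v r L

theorem gsel_sublist (v : α → ℚ) (L : List α) : ∀ r, (gsel v r L).Sublist L := by
  induction L with
  | nil => intro r; simp [gsel]
  | cons c L ih =>
    intro r
    simp only [gsel]
    split_ifs
    · exact (ih _).cons_cons c
    · exact (ih _).cons c

theorem gleft_sublist (v : α → ℚ) (L : List α) : ∀ r, (gleft v r L).Sublist L := by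
  induction L with
  | nil => intro r; simp [gleft]
  | cons c L ih =>
    intro r
    simp only [gleft]
    split_ifs
    · exact (ih _).cons c
    · exact (ih _).cons_cons c

theorem mem_gleft (v : α → ℚ) (L : List α) : ∀ r, L.Nodup → ∀ a,
    (a ∈ gleft v r L ↔ a ∈ L ∧ a ∉ gsel v r L) := by
  induction L with
  | nil => intro r; simp [gleft]
  | cons c L ih =>
    intro r hn a
    rw [List.nodup_cons] at hn
    have h1 := (gsel_sublist v L r).subset
    simp only [gleft, gsel]
    split_ifs
    · rw [ih _ hn.2]
      simp only [List.mem_cons]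
      constructor
      · rintro ⟨h, h'⟩
        refine ⟨Or.inr h, ?_⟩
        rintro (rfl | h2)
        · exact hn.1 h
        · exact h' h2
      · rintro ⟨h, h'⟩
        push Not at h'
        exact ⟨h.resolve_left h'.1, h'.2⟩
    · simp only [List.mem_cons]
      rw [ih _ hn.2]
      constructor
      · rintro (rfl | h)
        · exact ⟨Or.inl rfl, fun h => hn.1 (h1 h)⟩
        · exact ⟨Or.inr h.1, h.2⟩
      · rintro ⟨h | h, h'⟩
        · exact Or.inl h
        · exact Or.inr ⟨h, h'⟩

theorem gsel_sum (v : α → ℚ) (L : List α) : ∀ r, 0 ≤ r → ((gsel v r L).map v).sum ≤ r := by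
  induction L with
  | nil => intro r hr; simpa [gsel] using hr
  | cons c L ih =>
    intro r hr
    simp only [gsel]
    split_ifs with h
    · have := ih (r - v c) (by linarith)
      simp only [List.map_cons, List.sum_cons]
      linarith
    · exact ih r hr

theorem foldl_cons_bin (v : α → ℚ) (τ : ℚ) (L : List α) : ∀ (A : Finset α) (rest : List (Finset α)),
    L.Nodup → (∀ c ∈ L, c ∉ A) →
    L.foldl (fun bins c => ffdInsert v τ c bins) (A :: rest) =
      (A ∪ (gsel v (τ - bundleCost v A) L).toFinset) ::
        (gleft v (τ - bundleCost v A) L).foldl (fun bins c => ffdInsert v τ c bins) rest := by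
  induction L with
  | nil => intro A rest _ _; simp [gsel, gleft]
  | cons c L ih =>
    intro A rest hn hA
    rw [List.nodup_cons] at hn
    have hcA : c ∉ A := hA c (by simp)
    simp only [List.foldl_cons, ffdInsert, gsel, gleft]
    by_cases h : bundleCost v A + v c ≤ τ
    · have h2 : v c ≤ τ - bundleCost v A := by linarith
      have h3 : τ - bundleCost v (insert c A) = τ - bundleCost v A - v c := by
        simp only [bundleCost, Finset.sum_insert hcA]; ring
      rw [if_pos h, if_pos h2, if_pos h2, ih _ _ hn.2, h3]
      · congr 1
        ext x; simp
      · intro x hx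
        rw [Finset.mem_insert]
        rintro (rfl | h')
        · exact hn.1 hx
        · exact hA x (by simp [hx]) h'
    · have h2 : ¬ v c ≤ τ - bundleCost v A := by intro h'; exact h (by linarith)
      rw [if_neg h, if_neg h2, if_neg h2, ih _ _ hn.2 (fun x hx => hA x (by simp [hx]))]
      simp only [List.foldl_cons]

theorem ffdBins_unfold (v : α → ℚ) (τ : ℚ) (L : List α) (hn : L.Nodup) :
    (ffdBins v τ L = [] ∧ ∀ c ∈ L, τ < v c) ∨
      ffdBins v τ L = (gsel v τ L).toFinset :: ffdBins v τ (gleft v τ L) := by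
  induction L with
  | nil => left; simp [ffdBins]
  | cons c L ih =>
    rw [List.nodup_cons] at hn
    by_cases h : v c ≤ τ
    · right
      have hc : bundleCost v {c} = v c := by simp [bundleCost]
      have := foldl_cons_bin v τ L {c} [] hn.2 (by
        intro x hx; rw [Finset.mem_singleton]; rintro rfl; exact hn.1 hx)
      simp only [ffdBins, List.foldl_cons, ffdInsert, gsel, gleft, if_pos h]
      rw [this, hc]
      congr 1
      ext x; simp
    · have h0 : ∀ X, ffdBins v τ (c :: X) = ffdBins v τ X := by
        intro X; simp [ffdBins, ffdInsert, h]
      simp only [gsel, gleft, if_neg h, h0]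
      rcases ih hn.2 with ⟨h1, h2⟩ | h1
      · left
        refine ⟨h1, ?_⟩
        intro x hx
        rcases List.mem_cons.1 hx with rfl | hx
        · exact not_le.1 h
        · exact h2 x hx
      · right; exact h1

theorem costSeq_toFinset (v : α → ℚ) (X : List α) (hn : X.Nodup)
    (hp : X.Pairwise fun c c' => v c' ≤ v c) (p : ℕ) :
    costSeq v X.toFinset p = (X.map v).getD p 0 := by
  have h1 : X.toFinset.val.map v = ((X.map v : List ℚ) : Multiset ℚ) := by
    rw [List.toFinset_val, hn.dedup]; rfl
  have h2 : ((X.toFinset.val.map v).sort (· ≤ ·)) = (X.map v).reverse := by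
    refine List.Perm.eq_of_pairwise (le := (· ≤ ·)) (fun a b _ _ h h' => le_antisymm h h')
      (Multiset.pairwise_sort _ _) ?_ ?_
    · rw [List.pairwise_reverse, List.pairwise_map]; exact hp
    · rw [← Multiset.coe_eq_coe, Multiset.sort_eq, h1]
      exact (Multiset.coe_eq_coe.2 (List.reverse_perm _)).symm
  unfold costSeq
  rw [h2, List.reverse_reverse]

/-- Lexicographic comparison of padded sequences. -/
def SeqLe (f g : ℕ → ℚ) : Prop :=
  (∀ p, f p = g p) ∨ ∃ q, (∀ p < q, f p = g p) ∧ f q < g q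

theorem SeqLe_cons (x : ℚ) (l m : List ℚ) (h : SeqLe (fun p => l.getD p 0) (fun p => m.getD p 0)) :
    SeqLe (fun p => (x :: l).getD p 0) (fun p => (x :: m).getD p 0) := by
  rcases h with h | ⟨q, h, h'⟩
  · left
    rintro (_ | p)
    · simp
    · simpa using h p
  · right
    refine ⟨q + 1, ?_, by simpa using h'⟩
    rintro (_ | p) hp
    · simp
    · simpa using h p (by omega)

theorem greedy_lex (v : α → ℚ) (L : List α) : ∀ (r : ℚ) (Y : List α),
    (∀ c ∈ L, 0 < v c) → L.Pairwise (fun c c' => v c' ≤ v c) → Y.Sublist L →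
    (Y.map v).sum ≤ r →
    SeqLe (fun p => (Y.map v).getD p 0) (fun p => ((gsel v r L).map v).getD p 0) := by
  induction L with
  | nil =>
    intro r Y _ _ hY _
    rw [List.sublist_nil] at hY
    subst hY
    left; simp [gsel]
  | cons c L ih =>
    intro r Y hpos hp hY hs
    rw [List.pairwise_cons] at hp
    have hpos' : ∀ c ∈ L, 0 < v c := fun x hx => hpos x (by simp [hx])
    simp only [gsel]
    rcases List.sublist_cons_iff.1 hY with hY | ⟨Y', rfl, hY'⟩
    · split_ifs with h
      · cases Y with
        | nil =>
          right
          exact ⟨0, by simp, by simpa using hpos c (by simp)⟩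
        | cons y Y =>
          have hyc : v y ≤ v c := hp.1 y (hY.subset (by simp))
          rcases hyc.lt_or_eq with hlt | heq
          · right
            exact ⟨0, by simp, by simpa using hlt⟩
          · simp only [List.map_cons, List.sum_cons] at hs ⊢
            rw [heq] at hs ⊢
            exact SeqLe_cons _ _ _ (ih _ _ hpos' hp.2 ((List.sublist_cons_self y Y).trans hY)
              (by linarith))
      · exact ih r Y hpos' hp.2 hY hs
    · simp only [List.map_cons, List.sum_cons] at hs
      have h0 : 0 ≤ (Y'.map v).sum := by
        apply List.sum_nonneg
        intro x hx
        obtain ⟨a, ha, rfl⟩ := List.mem_map.1 hx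
        exact (hpos' a (hY'.subset ha)).le
      rw [if_pos (by linarith)]
      simp only [List.map_cons]
      exact SeqLe_cons _ _ _ (ih _ _ hpos' hp.2 hY' (by linarith))

theorem SeqLe_antisymm (f g : ℕ → ℚ) (h : SeqLe f g) (h' : SeqLe g f) : ∀ p, f p = g p := by
  rcases h with h | ⟨q, h1, h2⟩
  · exact h
  rcases h' with h | ⟨q', h3, h4⟩
  · exact fun p => (h p).symm
  exfalso
  rcases lt_trichotomy q q' with hq | rfl | hq
  · exact absurd (h3 q hq) h2.ne'
  · exact absurd h2 h4.le.not_gt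
  · exact absurd (h1 q' hq) h4.ne'

theorem bundleCost_toFinset (v : α → ℚ) (X : List α) (hn : X.Nodup) :
    bundleCost v X.toFinset = (X.map v).sum := by
  rw [bundleCost, List.sum_toFinset _ hn]

theorem first_bin (v : α → ℚ) (τ : ℚ) (hτ : 0 ≤ τ) (L : List α) (hn : L.Nodup)
    (hp : L.Pairwise fun c c' => v c' ≤ v c) (hv : ∀ c ∈ L, 0 < v c) (B : Finset α)
    (hBL : B ⊆ L.toFinset) (hBc : bundleCost v B ≤ τ)
    (hB : ∀ B' ⊆ L.toFinset, bundleCost v B' ≤ τ → LexGe v B B') :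
    LexEq v (gsel v τ L).toFinset B := by
  have hsub := gsel_sublist v L τ
  have hgn := hn.sublist hsub
  apply SeqLe_antisymm
  · refine hB _ ?_ ?_
    · intro x hx
      rw [List.mem_toFinset] at hx ⊢
      exact hsub.subset hx
    · rw [bundleCost_toFinset v _ hgn]
      exact gsel_sum v L τ hτ
  · have hYs : (L.filter (· ∈ B)).Sublist L := List.filter_sublist
    have hYn := hn.sublist hYs
    have hYB : (L.filter (· ∈ B)).toFinset = B := by
      ext x
      simp only [List.mem_toFinset, List.mem_filter, decide_eq_true_eq]
      exact ⟨fun h => h.2, fun h => ⟨List.mem_toFinset.1 (hBL h), h⟩⟩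
    have e1 : costSeq v B = fun p => ((L.filter (· ∈ B)).map v).getD p 0 := by
      funext p
      rw [← costSeq_toFinset v _ hYn (hp.sublist hYs), hYB]
    have e2 : costSeq v (gsel v τ L).toFinset = fun p => ((gsel v τ L).map v).getD p 0 := by
      funext p
      rw [← costSeq_toFinset v _ hgn (hp.sublist hsub)]
    rw [e1, e2]
    refine greedy_lex v L τ _ hv hp hYs ?_
    rw [← bundleCost_toFinset v _ hYn, hYB]
    exact hBc

/-- every bin produced by FFD is lexicographically equal to the corresponding
benchmark bundle. -/
theorem ffd_bin_lexEq_benchmark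
    (M : Finset α) (v : α → ℚ) (hv : ∀ c ∈ M, 0 < v c) (τ : ℚ)
    (L : List α) (hL : IsFFDList v M L)
    (i : ℕ) (B : Finset α)
    (hB : IsBenchmarkList M (ffdBins v τ L) v τ i B) :
    LexEq v ((ffdBins v τ L).getD i ∅) B := by
  obtain ⟨rfl, hn, hp⟩ := hL
  have hτ : 0 ≤ τ := by
    refine le_trans (Finset.sum_nonneg ?_) hB.2.1
    intro c hc
    exact (hv c (Finset.mem_sdiff.1 (hB.1 hc)).1).le
  induction i generalizing L with
  | zero =>
    have hr : remainingList L.toFinset (ffdBins v τ L) 0 = L.toFinset := by simp [remainingList]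
    rw [IsBenchmarkList, hr] at hB
    have key := first_bin v τ hτ L hn hp (fun c hc => hv c (List.mem_toFinset.2 hc)) B
      hB.1 hB.2.1 hB.2.2
    rcases ffdBins_unfold v τ L hn with ⟨h1, h2⟩ | h1
    · have hBe : B = ∅ := by
        rw [Finset.eq_empty_iff_forall_notMem]
        intro c hc
        have h3 : v c ≤ bundleCost v B :=
          Finset.single_le_sum (f := v) (fun x hx => (hv x (hB.1 hx)).le) hc
        have := h2 c (List.mem_toFinset.1 (hB.1 hc))
        linarith [hB.2.1]
      rw [h1, hBe]
      intro p; rfl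
    · rw [h1]; exact key
  | succ k ih =>
    rcases ffdBins_unfold v τ L hn with ⟨h1, h2⟩ | h1
    · have hBe : B = ∅ := by
        rw [Finset.eq_empty_iff_forall_notMem]
        intro c hc
        have hsub : ∀ x ∈ B, x ∈ L.toFinset := fun x hx => (Finset.mem_sdiff.1 (hB.1 hx)).1
        have h3 : v c ≤ bundleCost v B :=
          Finset.single_le_sum (f := v) (fun x hx => (hv x (hsub x hx)).le) hc
        have := h2 c (List.mem_toFinset.1 (hsub c hc))
        linarith [hB.2.1]
      rw [h1, hBe]
      intro p; rfl
    · have hs := gleft_sublist v L τ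
      have hr : remainingList L.toFinset (ffdBins v τ L) (k + 1) =
          remainingList (gleft v τ L).toFinset (ffdBins v τ (gleft v τ L)) k := by
        rw [h1]
        ext x
        simp only [remainingList, List.take_succ_cons, List.foldr_cons, Finset.mem_sdiff,
          Finset.mem_union, List.mem_toFinset, mem_gleft v L τ hn]
        tauto
      rw [IsBenchmarkList, hr] at hB
      have := ih (gleft v τ L)
        (fun c hc => hv c (List.mem_toFinset.2 (hs.subset (List.mem_toFinset.1 hc))))
        hB (hn.sublist hs) (hp.sublist hs)
      rw [h1]
      simpa using this
end

section
/- Consider an IDO chore instance with n agents and any threshold vector (τ_1,…,τ_n). Suppose HFFD produces a collection of bundles (A_1,…,A_n), assigned in this order, and let ℓ denote the agent that receives the last bundle A_n. Then for every τ ≤ τ_ℓ, the tuple (M, (A_1,…,A_n), v_ℓ, τ) is First Fit Valid. -/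
open Finset

variable {α : Type*} [DecidableEq α]

/-- The chores of `M` remaining after the first `k` bundles of `A` have been allocated. -/
def remainingChores (M : Finset α) {n : ℕ} (A : Fin n → Finset α) (k : Fin n) : Finset α :=
  M \ (Finset.univ.filter fun j => j < k).biUnion A

/-- `B` is a `k`-th benchmark bundle of `A` w.r.t. `M`, `v`, `τ`: a lexicographically
maximal subset of the remaining chores with cost at most `τ`. -/
def IsBenchmark (M : Finset α) {n : ℕ} (A : Fin n → Finset α) (v : α → ℚ) (τ : ℚ)
    (k : Fin n) (B : Finset α) : Prop :=
  B ⊆ remainingChores M A k ∧ bundleCost v B ≤ τ ∧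
    ∀ B' ⊆ remainingChores M A k, bundleCost v B' ≤ τ → LexGe v B B'

/-- The tuple `(M, A, v, τ)` is First Fit Valid. -/
def FirstFitValid (M : Finset α) {n : ℕ} (A : Fin n → Finset α) (v : α → ℚ) (τ : ℚ) : Prop :=
  (∀ k, A k ⊆ M) ∧ (∀ j k, j ≠ k → Disjoint (A j) (A k)) ∧
    ∀ k B, IsBenchmark M A v τ k B → LexGe v (A k) B

/-- Build one HFFD bundle: scan the remaining chores in order, adding a chore iff after
adding it the bundle's cost is at most `τ i` under `v i` for at least one remaining agent `i`. -/
def hffdBundle {n : ℕ} (v : Fin n → α → ℚ) (τ : Fin n → ℚ)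
    (Ag : Finset (Fin n)) : List α → Finset α → Finset α
  | [], B => B
  | c :: R, B =>
      if ∃ i ∈ Ag, bundleCost (v i) (insert c B) ≤ τ i then
        hffdBundle v τ Ag R (insert c B)
      else hffdBundle v τ Ag R B

/-- The state of HFFD (remaining chores, remaining agents) after `k` bundles have been
built, where `σ j` is the agent to whom the `j`-th bundle is assigned. -/
def hffdState {n : ℕ} (v : Fin n → α → ℚ) (τ : Fin n → ℚ)
    (L : List α) (σ : ℕ → Fin n) : ℕ → List α × Finset (Fin n)
  | 0 => (L, Finset.univ)
  | k + 1 =>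
      let s := hffdState v τ L σ k
      let B := hffdBundle v τ s.2 s.1 ∅
      (s.1.filter fun c => c ∉ B, s.2.erase (σ k))

/-- The `k`-th bundle built by HFFD (0-indexed). -/
def hffdBundleAt {n : ℕ} (v : Fin n → α → ℚ) (τ : Fin n → ℚ)
    (L : List α) (σ : ℕ → Fin n) (k : ℕ) : Finset α :=
  hffdBundle v τ (hffdState v τ L σ k).2 (hffdState v τ L σ k).1 ∅

/-- `σ` is a valid execution of HFFD: each bundle is assigned to a remaining agent
for whom its cost is at most that agent's threshold. -/
def ValidHFFDRun {n : ℕ} (v : Fin n → α → ℚ) (τ : Fin n → ℚ)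
    (L : List α) (σ : ℕ → Fin n) : Prop :=
  ∀ k < n, σ k ∈ (hffdState v τ L σ k).2 ∧
    bundleCost (v (σ k)) (hffdBundleAt v τ L σ k) ≤ τ (σ k)

/-- `L` is a universal ordering witnessing that the instance is IDO: an enumeration of `M`
that is non-increasing w.r.t. every agent's cost function. -/
def IsUniversalOrder {n : ℕ} (v : Fin n → α → ℚ) (M : Finset α) (L : List α) : Prop :=
  L.toFinset = M ∧ L.Nodup ∧ ∀ i, L.Pairwise fun c c' => v i c' ≤ v i c

theorem lex_list_aux (q : ℕ) : ∀ (la lb : List ℚ), la.Pairwise (fun a b => b ≤ a) →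
    lb.Pairwise (fun a b => b ≤ a) → (∀ a ∈ la, 0 ≤ a) → (∀ b ∈ lb, 0 ≤ b) →
    (∀ p < q, la.getD p 0 = lb.getD p 0) → la.getD q 0 < lb.getD q 0 →
    ∃ y, la.count y < lb.count y ∧ (la.filter (fun a => y ≤ a)).sum + y ≤ lb.sum := by
  induction q with
  | zero =>
    intro la lb hla hlb ha hb _ h
    cases lb with
    | nil =>
      cases la with
      | nil => simp at h
      | cons a la =>
        have := ha a (by simp)
        simp at h
        linarith
    | cons b lb =>
      have hf : ∀ a ∈ la, a < b := by
        cases la with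
        | nil => simp
        | cons a la =>
          simp at h
          intro c hc
          rcases List.mem_cons.1 hc with rfl | hc
          · exact h
          · exact lt_of_le_of_lt ((List.pairwise_cons.1 hla).1 c hc) h
      refine ⟨b, ?_, ?_⟩
      · have : la.count b = 0 := List.count_eq_zero.2 fun hm => lt_irrefl _ (hf b hm)
        rw [this]
        simp
      · have : la.filter (fun a => b ≤ a) = [] := by
          rw [List.filter_eq_nil_iff]
          intro a ha'
          simpa using hf a ha'
        rw [this]
        have : 0 ≤ lb.sum := List.sum_nonneg fun c hc => hb c (by simp [hc])
        simp
        exact this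
  | succ q ih =>
    intro la lb hla hlb ha hb he h
    have h0 := he 0 (by omega)
    cases lb with
    | nil =>
      exfalso
      rw [List.getD_nil] at h
      rcases lt_or_ge (q + 1) la.length with hl | hl
      · rw [List.getD_eq_getElem _ _ hl] at h
        have := ha _ (List.getElem_mem hl)
        linarith
      · rw [List.getD_eq_default _ _ hl] at h
        exact lt_irrefl _ h
    | cons b lb =>
      cases la with
      | nil =>
        refine ⟨b, by simp, ?_⟩
        have : 0 ≤ lb.sum := List.sum_nonneg fun c hc => hb c (by simp [hc])
        simp
        exact this
      | cons a la =>
        simp at h0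
        subst h0
        rw [List.pairwise_cons] at hla hlb
        obtain ⟨y, h1, h2⟩ := ih la lb hla.2 hlb.2 (fun c hc => ha c (by simp [hc]))
          (fun c hc => hb c (by simp [hc]))
          (fun p hp => by simpa using he (p + 1) (by omega)) (by simpa using h)
        have hy : y ≤ a := hlb.1 y (List.count_pos_iff.1 (by omega))
        refine ⟨y, ?_, ?_⟩
        · simp only [List.count_cons]
          omega
        · rw [List.filter_cons_of_pos (by simpa using hy), List.sum_cons, List.sum_cons]
          linarith

theorem not_lexGe_aux {α : Type*} [DecidableEq α] (v : α → ℚ) (A B : Finset α)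
    (hA : ∀ a ∈ A, 0 ≤ v a) (hB : ∀ b ∈ B, 0 ≤ v b) (h : ¬ LexGe v A B) :
    ∃ b ∈ B, b ∉ A ∧ bundleCost v (A.filter fun a => v b ≤ v a) + v b ≤ bundleCost v B := by
  classical
  have hq : ∃ q, (∀ p < q, costSeq v A p = costSeq v B p) ∧ costSeq v A q < costSeq v B q := by
    unfold LexGe LexLe LexEq at h
    push Not at h
    obtain ⟨h1, h2⟩ := h
    refine ⟨Nat.find h1, fun p hp => ?_, ?_⟩
    · have := Nat.find_min h1 hp
      push Not at this
      exact this.symm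
    · have h3 := h2 (Nat.find h1) fun p hp => by
        have := Nat.find_min h1 hp
        push Not at this
        exact this
      exact lt_of_le_of_ne h3 (Ne.symm (Nat.find_spec h1))
  obtain ⟨q, hq1, hq2⟩ := hq
  have perm : ∀ S : Finset α, (((S.val.map v).sort (· ≤ ·)).reverse : Multiset ℚ) = S.val.map v := by
    intro S
    rw [← Multiset.coe_reverse, List.reverse_reverse, Multiset.sort_eq]
  have sorted : ∀ S : Finset α,
      ((S.val.map v).sort (· ≤ ·)).reverse.Pairwise (fun a b => b ≤ a) := by
    intro S
    rw [List.pairwise_reverse]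
    exact Multiset.pairwise_sort _ _
  have nonneg : ∀ S : Finset α, (∀ a ∈ S, 0 ≤ v a) →
      ∀ a ∈ ((S.val.map v).sort (· ≤ ·)).reverse, 0 ≤ a := by
    intro S hS a ha
    rw [← Multiset.mem_coe, perm, Multiset.mem_map] at ha
    obtain ⟨c, hc, rfl⟩ := ha
    exact hS c hc
  obtain ⟨y, h1, h2⟩ := lex_list_aux q _ _ (sorted A) (sorted B) (nonneg A hA) (nonneg B hB) hq1 hq2
  rw [← Multiset.coe_count, ← Multiset.coe_count, perm, perm] at h1
  rw [← Multiset.sum_coe, ← Multiset.sum_coe, ← Multiset.filter_coe, perm, perm] at h2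
  have h3 : ∃ b ∈ B, b ∉ A ∧ v b = y := by
    by_contra hcon
    push Not at hcon
    rw [Multiset.count_map, Multiset.count_map] at h1
    apply absurd h1
    rw [not_lt]
    apply Multiset.card_le_card
    rw [Multiset.le_iff_subset (B.nodup.filter _)]
    intro b hb
    rw [Multiset.mem_filter] at hb ⊢
    refine ⟨?_, hb.2⟩
    by_contra hbA
    exact hcon b hb.1 hbA hb.2.symm
  obtain ⟨b, hb, hbA, rfl⟩ := h3
  refine ⟨b, hb, hbA, ?_⟩
  rw [Multiset.filter_map] at h2
  exact h2

theorem subset_hffdBundle {α : Type*} [DecidableEq α] {n : ℕ} (v : Fin n → α → ℚ) (τ : Fin n → ℚ)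
    (Ag : Finset (Fin n)) (R : List α) : ∀ B, B ⊆ hffdBundle v τ Ag R B := by
  induction R with
  | nil => intro B; exact subset_rfl
  | cons c R ih =>
    intro B
    unfold hffdBundle
    split_ifs
    · exact (Finset.subset_insert c B).trans (ih _)
    · exact ih _

theorem hffdBundle_subset {α : Type*} [DecidableEq α] {n : ℕ} (v : Fin n → α → ℚ) (τ : Fin n → ℚ)
    (Ag : Finset (Fin n)) (R : List α) :
    ∀ B, ∀ c ∈ hffdBundle v τ Ag R B, c ∈ B ∨ c ∈ R := by
  induction R with
  | nil => intro B c hc; exact Or.inl hc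
  | cons d R ih =>
    intro B c hc
    unfold hffdBundle at hc
    split_ifs at hc
    · have := ih _ c hc
      rw [Finset.mem_insert] at this
      rw [List.mem_cons]
      tauto
    · have := ih _ c hc
      rw [List.mem_cons]
      tauto

theorem hffdBundle_skip {α : Type*} [DecidableEq α] {n : ℕ} (v : Fin n → α → ℚ) (τ : Fin n → ℚ)
    (Ag : Finset (Fin n)) (i : Fin n) (hi : i ∈ Ag) (b : α) (R : List α) :
    ∀ B, R.Pairwise (fun c c' => v i c' ≤ v i c) → (∀ c ∈ B, ∀ r ∈ R, v i r ≤ v i c) →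
      (∀ c ∈ hffdBundle v τ Ag R B, 0 ≤ v i c) → b ∈ R → b ∉ hffdBundle v τ Ag R B →
      τ i < bundleCost (v i) ((hffdBundle v τ Ag R B).filter fun a => v i b ≤ v i a) + v i b := by
  induction R with
  | nil => intro B _ _ _ hb; simp at hb
  | cons d R ih =>
    intro B hR hB hpos hb hbA
    have hsub := subset_hffdBundle v τ Ag (d :: R) B
    rw [List.pairwise_cons] at hR
    by_cases hbd : b = d
    · subst hbd
      have hsk : ¬ ∃ i ∈ Ag, bundleCost (v i) (insert b B) ≤ τ i := by
        intro hex
        apply hbA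
        unfold hffdBundle
        rw [if_pos hex]
        exact subset_hffdBundle v τ Ag R _ (Finset.mem_insert_self b B)
      have h1 : τ i < bundleCost (v i) (insert b B) := by
        by_contra hcon
        exact hsk ⟨i, hi, not_lt.1 hcon⟩
      have hbB : b ∉ B := fun h => hbA (hsub h)
      unfold bundleCost at h1 ⊢
      rw [Finset.sum_insert hbB] at h1
      have h2 : ∑ c ∈ B, v i c ≤
          ∑ c ∈ (hffdBundle v τ Ag (b :: R) B).filter (fun a => v i b ≤ v i a), v i c := by
        apply Finset.sum_le_sum_of_subset_of_nonneg
        · intro c hc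
          rw [Finset.mem_filter]
          exact ⟨hsub hc, hB c hc b (by simp)⟩
        · intro c hc _
          exact hpos c (Finset.mem_filter.1 hc).1
      linarith
    · have hbR : b ∈ R := by
        rcases List.mem_cons.1 hb with h | h
        · exact absurd h hbd
        · exact h
      have hB' : ∀ c ∈ B, ∀ r ∈ R, v i r ≤ v i c := fun c hc r hr => hB c hc r (by simp [hr])
      unfold hffdBundle at hpos hbA ⊢
      split_ifs at hpos hbA ⊢
      · refine ih _ hR.2 ?_ hpos hbR hbA
        intro c hc r hr
        rcases Finset.mem_insert.1 hc with rfl | hc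
        · exact hR.1 r hr
        · exact hB' c hc r hr
      · exact ih _ hR.2 hB' hpos hbR hbA

theorem hffdState_sublist {α : Type*} [DecidableEq α] {n : ℕ} (v : Fin n → α → ℚ) (τ : Fin n → ℚ)
    (L : List α) (σ : ℕ → Fin n) (k : ℕ) : (hffdState v τ L σ k).1.Sublist L := by
  induction k with
  | zero => exact List.Sublist.refl _
  | succ k ih => exact List.filter_sublist.trans ih

theorem mem_hffdState {α : Type*} [DecidableEq α] {n : ℕ} (v : Fin n → α → ℚ) (τ : Fin n → ℚ)
    (L : List α) (σ : ℕ → Fin n) (c : α) (k : ℕ) : c ∈ (hffdState v τ L σ k).1 ↔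
      c ∈ L ∧ ∀ j < k, c ∉ hffdBundleAt v τ L σ j := by
  induction k with
  | zero => simp [hffdState]
  | succ k ih =>
    have : c ∈ (hffdState v τ L σ (k + 1)).1 ↔
        c ∈ (hffdState v τ L σ k).1 ∧ c ∉ hffdBundleAt v τ L σ k := by
      simp [hffdState, hffdBundleAt]
    rw [this, ih, Nat.forall_lt_succ_right, and_assoc]

theorem hffdState_agents {α : Type*} [DecidableEq α] {n : ℕ} (v : Fin n → α → ℚ) (τ : Fin n → ℚ)
    (L : List α) (σ : ℕ → Fin n) {j k : ℕ} (h : j ≤ k) :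
    (hffdState v τ L σ k).2 ⊆ (hffdState v τ L σ j).2 := by
  induction k, h using Nat.le_induction with
  | base => exact subset_rfl
  | succ k _ ih => exact (Finset.erase_subset _ _).trans ih

theorem mem_hffdBundleAt {α : Type*} [DecidableEq α] {n : ℕ} (v : Fin n → α → ℚ) (τ : Fin n → ℚ)
    (L : List α) (σ : ℕ → Fin n) (k : ℕ) (c : α) (h : c ∈ hffdBundleAt v τ L σ k) :
    c ∈ (hffdState v τ L σ k).1 := by
  rcases hffdBundle_subset _ _ _ _ _ c h with h | h
  · simp at h
  · exact h

/-- the bundle collection produced by HFFD is First Fit Valid for the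
cost function of the last agent `ℓ = σ (n-1)` and for any threshold `τ' ≤ τ ℓ`. -/
theorem hffd_output_first_fit_valid
    (n : ℕ) (hn : 0 < n) (M : Finset α)
    (v : Fin n → α → ℚ) (hv : ∀ i, ∀ c ∈ M, 0 < v i c)
    (L : List α) (hL : IsUniversalOrder v M L)
    (τ : Fin n → ℚ) (σ : ℕ → Fin n) (hσ : ValidHFFDRun v τ L σ)
    (τ' : ℚ) (hτ' : τ' ≤ τ (σ (n - 1))) :
    FirstFitValid M (fun k : Fin n => hffdBundleAt v τ L σ (k : ℕ)) (v (σ (n - 1))) τ' := by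
  obtain ⟨hLM, -, hLs⟩ := hL
  have hsubM : ∀ k c, c ∈ (hffdState v τ L σ k).1 → c ∈ M := by
    intro k c hc
    rw [← hLM, List.mem_toFinset]
    exact (hffdState_sublist v τ L σ k).subset hc
  refine ⟨fun k c hc => hsubM _ c (mem_hffdBundleAt v τ L σ k c hc), ?_, ?_⟩
  · have key : ∀ j k : ℕ, j < k →
        Disjoint (hffdBundleAt v τ L σ j) (hffdBundleAt v τ L σ k) := by
      intro j k hjk
      rw [Finset.disjoint_right]
      intro c hc
      exact ((mem_hffdState v τ L σ c k).1 (mem_hffdBundleAt v τ L σ k c hc)).2 j hjk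
    intro j k hjk
    rcases lt_or_gt_of_ne hjk with h | h
    · exact key j k h
    · exact (key k j h).symm
  · intro k B hB
    obtain ⟨hBR, hBc, -⟩ := hB
    have hBs : ∀ b ∈ B, b ∈ (hffdState v τ L σ k).1 := by
      intro b hb
      have := hBR hb
      unfold remainingChores at this
      rw [Finset.mem_sdiff, Finset.mem_biUnion] at this
      rw [mem_hffdState]
      refine ⟨?_, ?_⟩
      · rw [← List.mem_toFinset, hLM]
        exact this.1
      · intro j hj hbj
        exact this.2 ⟨⟨j, hj.trans k.2⟩, Finset.mem_filter.2 ⟨Finset.mem_univ _, hj⟩, hbj⟩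
    have hA0 : ∀ a ∈ hffdBundleAt v τ L σ k, 0 ≤ v (σ (n - 1)) a := fun a ha =>
      (hv _ a (hsubM _ a (mem_hffdBundleAt v τ L σ k a ha))).le
    by_contra hcon
    obtain ⟨b, hb, hbA, hle⟩ := not_lexGe_aux _ _ _ hA0
      (fun b hb => (hv _ b (hsubM _ b (hBs b hb))).le) hcon
    have hag : σ (n - 1) ∈ (hffdState v τ L σ k).2 :=
      hffdState_agents v τ L σ (by omega : (k : ℕ) ≤ n - 1) (hσ (n - 1) (by omega)).1
    have := hffdBundle_skip v τ _ _ hag b _ ∅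
      ((hLs (σ (n - 1))).sublist (hffdState_sublist v τ L σ k)) (by simp) hA0 (hBs b hb) hbA
    unfold hffdBundleAt at hle
    linarith
end

section
/- (Reduction Lemma for factored instances.) Let τ > 0 and let v be a factored cost function on a finite set M of chores. If FFD(M, v, τ) allocates all the chores into n bins, and (M, (Q_1,…,Q_n), v, τ) is a First Fit Valid tuple, then Q_1 ∪ … ∪ Q_n = M. -/
open Finset

variable {α : Type*} [DecidableEq α]

/-- `v` is factored on `M`: any two cost values are comparable under divisibility,
the smaller dividing the larger with a positive integer quotient. -/
def Factored (v : α → ℚ) (M : Finset α) : Prop :=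
  ∀ c ∈ M, ∀ c' ∈ M, v c ≤ v c' → ∃ q : ℕ, 0 < q ∧ v c' = q * v c

lemma aux_costSeq_eq (v : α → ℚ) (B : Finset α) (l : List ℚ) (hl : (l : Multiset ℚ) = B.val.map v)
    (hs : l.Pairwise (· ≥ ·)) (p : ℕ) : costSeq v B p = l.getD p 0 := by
  have h : ((B.val.map v).sort (· ≤ ·)).reverse = l := by
    refine List.Perm.eq_of_pairwise' (r := (· ≥ ·)) ?_ hs ?_
    · rw [List.pairwise_reverse]
      exact Multiset.pairwise_sort _ _
    · refine (List.reverse_perm _).trans ?_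
      rw [← Multiset.coe_eq_coe, Multiset.sort_eq, hl]
  unfold costSeq
  rw [h]

lemma aux_exists_list (v : α → ℚ) (B : Finset α) :
    ∃ l : List ℚ, (l : Multiset ℚ) = B.val.map v ∧ l.Pairwise (· ≥ ·) := by
  refine ⟨((B.val.map v).sort (· ≤ ·)).reverse, ?_, ?_⟩
  · rw [Multiset.coe_reverse, Multiset.sort_eq]
  · rw [List.pairwise_reverse]
    exact Multiset.pairwise_sort _ _

lemma aux_lexLe_iff (v : α → ℚ) (A B : Finset α) :
    LexLe v A B ↔ toLex (costSeq v A) ≤ toLex (costSeq v B) := by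
  rw [le_iff_eq_or_lt]
  unfold LexLe LexEq
  refine or_congr ?_ Iff.rfl
  rw [toLex_inj, funext_iff]

/-- Adding `c` to the part of `Q` of cost at least `v c` yields a strictly larger bundle. -/
lemma aux_lex_lt (v : α → ℚ) (Q : Finset α) (c : α) (hc : c ∉ Q) (hpos : 0 < v c) :
    ¬ LexLe v (insert c (Q.filter fun d => v c ≤ v d)) Q := by
  rw [aux_lexLe_iff, not_le]
  obtain ⟨l1, h1, s1⟩ := aux_exists_list v (Q.filter fun d => v c ≤ v d)
  obtain ⟨l2, h2, s2⟩ := aux_exists_list v (Q.filter fun d => ¬ v c ≤ v d)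
  have m1 : ∀ a ∈ l1, v c ≤ a := by
    intro a ha
    have : a ∈ (l1 : Multiset ℚ) := ha
    rw [h1, Multiset.mem_map] at this
    obtain ⟨d, hd, rfl⟩ := this
    exact (Finset.mem_filter.1 hd).2
  have m2 : ∀ a ∈ l2, a < v c := by
    intro a ha
    have : a ∈ (l2 : Multiset ℚ) := ha
    rw [h2, Multiset.mem_map] at this
    obtain ⟨d, hd, rfl⟩ := this
    exact not_le.1 (Finset.mem_filter.1 hd).2
  have e1 := aux_costSeq_eq v Q (l1 ++ l2) (by
      rw [← Multiset.coe_add, h1, h2, ← Multiset.map_add, Finset.filter_val, Finset.filter_val,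
        Multiset.filter_add_not]) (by
      rw [List.pairwise_append]
      exact ⟨s1, s2, fun a ha b hb => (m2 b hb).le.trans (m1 a ha)⟩)
  have e2 := aux_costSeq_eq v (insert c (Q.filter fun d => v c ≤ v d)) (l1 ++ [v c]) (by
      rw [Finset.insert_val_of_notMem (by simp [hc]), Multiset.map_cons, ← h1,
        ← Multiset.coe_add, add_comm]
      rfl) (by
      rw [List.pairwise_append]
      refine ⟨s1, by simp, fun a ha b hb => ?_⟩
      rw [List.mem_singleton] at hb
      subst hb
      exact m1 a ha)
  refine ⟨l1.length, fun p hp => ?_, ?_⟩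
  · change costSeq v Q p = costSeq v _ p
    rw [e1, e2, List.getD_append _ _ _ _ hp, List.getD_append _ _ _ _ hp]
  · change costSeq v Q _ < costSeq v _ _
    rw [e1, e2, List.getD_append_right _ _ _ _ le_rfl, List.getD_append_right _ _ _ _ le_rfl]
    cases l2 with
    | nil => simpa using hpos
    | cons a t => simpa using m2 a (by simp)

lemma aux_exists_benchmark (M : Finset α) {n : ℕ} (A : Fin n → Finset α) (v : α → ℚ) (τ : ℚ)
    (hτ : 0 < τ) (k : Fin n) : ∃ B, IsBenchmark M A v τ k B := by
  obtain ⟨B, hB, hmax⟩ := Finset.exists_max_image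
    ((remainingChores M A k).powerset.filter fun S => bundleCost v S ≤ τ)
    (fun S => toLex (costSeq v S)) ⟨∅, by rw [Finset.mem_filter]; exact ⟨by simp, by simpa [bundleCost] using hτ.le⟩⟩
  rw [Finset.mem_filter, Finset.mem_powerset] at hB
  refine ⟨B, hB.1, hB.2, fun B' h1 h2 => ?_⟩
  unfold LexGe
  rw [aux_lexLe_iff]
  exact hmax B' (by rw [Finset.mem_filter, Finset.mem_powerset]; exact ⟨h1, h2⟩)

/-- Total cost of the chores of `S` of cost at least `x`. -/
def auxVol (v : α → ℚ) (x : ℚ) (S : Finset α) : ℚ := ∑ c ∈ S.filter (fun d => x ≤ v d), v c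

lemma aux_le_floor (τ x t : ℚ) (hx : 0 < x) (m : ℤ) (ht : t = m * x) (h : t ≤ τ) :
    t ≤ ⌊τ / x⌋ * x := by
  have : m ≤ ⌊τ / x⌋ := by
    rw [Int.le_floor, le_div_iff₀ hx]
    linarith
  rw [ht]
  have h2 : (m : ℚ) ≤ ⌊τ / x⌋ := by exact_mod_cast this
  exact mul_le_mul_of_nonneg_right h2 hx.le

lemma aux_vol_multiple (v : α → ℚ) (M : Finset α) (hfac : Factored v M) (c : α) (hc : c ∈ M)
    (S : Finset α) (hS : S ⊆ M) : ∃ m : ℤ, auxVol v (v c) S = m * v c := by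
  unfold auxVol
  have : ∀ d ∈ S.filter (fun d => v c ≤ v d), ∃ q : ℤ, v d = q * v c := by
    intro d hd
    rw [Finset.mem_filter] at hd
    obtain ⟨q, -, hq⟩ := hfac c hc d (hS hd.1) hd.2
    exact ⟨q, by rw [hq]; push_cast; rfl⟩
  choose! f hf using this
  refine ⟨∑ d ∈ S.filter (fun d => v c ≤ v d), f d, ?_⟩
  rw [Finset.sum_congr rfl hf, ← Finset.sum_mul]
  push_cast
  rfl

lemma aux_vol_le (v : α → ℚ) (x : ℚ) (S : Finset α) (h : ∀ c ∈ S, 0 ≤ v c) :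
    auxVol v x S ≤ bundleCost v S := 
  Finset.sum_le_sum_of_subset_of_nonneg (Finset.filter_subset _ _) fun i hi _ => h i hi

lemma aux_ffdInsert (v : α → ℚ) (M : Finset α) (τ : ℚ) (hv : ∀ c ∈ M, 0 < v c) (c : α)
    (hc : c ∈ M) (l : List (Finset α)) (hl : ∀ B ∈ l, B ⊆ M ∧ bundleCost v B ≤ τ) :
    ∀ B ∈ ffdInsert v τ c l, B ⊆ M ∧ bundleCost v B ≤ τ := by
  induction l with
  | nil =>
    intro B hB
    unfold ffdInsert at hB
    split_ifs at hB with h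
    · rw [List.mem_singleton] at hB
      subst hB
      simpa [bundleCost, hc] using h
    · simp at hB
  | cons A t ih =>
    have hA := hl A (by simp)
    have ih' := ih fun B hB => hl B (by simp [hB])
    intro B hB
    unfold ffdInsert at hB
    split_ifs at hB with h
    · rcases List.mem_cons.1 hB with rfl | hB
      · refine ⟨Finset.insert_subset hc hA.1, ?_⟩
        by_cases hcA : c ∈ A
        · rw [Finset.insert_eq_of_mem hcA]; exact hA.2
        · unfold bundleCost at h ⊢
          rw [Finset.sum_insert hcA]; linarith
      · exact hl B (by simp [hB])
    · rcases List.mem_cons.1 hB with rfl | hB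
      · exact hA
      · exact ih' B hB

lemma aux_ffd (v : α → ℚ) (M : Finset α) (τ : ℚ) (hv : ∀ c ∈ M, 0 < v c) (L : List α) :
    ∀ (l : List (Finset α)), (∀ c ∈ L, c ∈ M) → (∀ B ∈ l, B ⊆ M ∧ bundleCost v B ≤ τ) →
    ∀ B ∈ L.foldl (fun bins c => ffdInsert v τ c bins) l, B ⊆ M ∧ bundleCost v B ≤ τ := by
  induction L with
  | nil => intro l _ h; exact h
  | cons c t ih =>
    intro l hL h
    rw [List.foldl_cons]
    exact ih _ (fun d hd => hL d (by simp [hd])) (aux_ffdInsert v M τ hv c (hL c (by simp)) l h)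

/-- A set covered by bins has volume at most (number of bins) times (volume bound per bin). -/
lemma aux_cover (v : α → ℚ) (x b : ℚ) (bins : List (Finset α))
    (h : ∀ B ∈ bins, (∀ c ∈ B, 0 < v c) ∧ auxVol v x B ≤ b) :
    ∀ S : Finset α, (∀ c ∈ S, ∃ B ∈ bins, c ∈ B) → auxVol v x S ≤ bins.length * b := by
  induction bins with
  | nil =>
    intro S hS
    have : S = ∅ := Finset.eq_empty_of_forall_notMem fun c hc => by simpa using hS c hc
    simp [this, auxVol]
  | cons A t ih =>
    intro S hS
    have hA := h A (by simp)
    have h1 := ih (fun B hB => h B (by simp [hB])) (S \ A) (by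
      intro c hc
      rw [Finset.mem_sdiff] at hc
      obtain ⟨B, hB, hcB⟩ := hS c hc.1
      rcases List.mem_cons.1 hB with rfl | hB
      · exact absurd hcB hc.2
      · exact ⟨B, hB, hcB⟩)
    have h2 : auxVol v x (S ∩ A) ≤ auxVol v x A := by
      refine Finset.sum_le_sum_of_subset_of_nonneg
        (Finset.filter_subset_filter _ Finset.inter_subset_right) fun i hi _ => ?_
      exact (hA.1 i (Finset.mem_filter.1 hi).1).le
    have h3 : auxVol v x S = auxVol v x (S \ A) + auxVol v x (S ∩ A) := by
      unfold auxVol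
      rw [← Finset.sum_union, ← Finset.filter_union, Finset.sdiff_union_inter]
      exact Finset.disjoint_filter_filter (Finset.disjoint_sdiff_inter S A)
    have := hA.2
    rw [List.length_cons]
    push_cast
    linarith

theorem reduction_lemma_factored
    (M : Finset α) (v : α → ℚ) (hv : ∀ c ∈ M, 0 < v c)
    (τ : ℚ) (hτ : 0 < τ) (hfac : Factored v M)
    (n : ℕ) (L : List α) (hL : IsFFDList v M L)
    (hffd : FFDAllocatesInto v τ L n)
    (Q : Fin n → Finset α) (hffv : FirstFitValid M Q v τ) :
    Finset.univ.biUnion Q = M := by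
  obtain ⟨hQM, hQd, hQ⟩ := hffv
  have hLM : ∀ c, c ∈ L ↔ c ∈ M := fun c => by rw [← hL.1, List.mem_toFinset]
  have hbins := aux_ffd v M τ hv L [] (fun c hc => (hLM c).1 hc) (by simp)
  have hfl0 : ∀ c ∈ M, (0 : ℚ) ≤ ⌊τ / v c⌋ * v c := fun c hc =>
    aux_le_floor τ (v c) 0 (hv c hc) 0 (by simp) hτ.le
  set R : ℕ → Finset α := fun k => M \ (Finset.univ.filter fun j : Fin n => (j : ℕ) < k).biUnion Q
    with hR
  have key : ∀ k ≤ n, ∀ c ∈ M, auxVol v (v c) (R k) ≤ (n - k : ℚ) * (⌊τ / v c⌋ * v c) := by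
    intro k
    induction k with
    | zero =>
      intro _ c hc
      have hR0 : R 0 = M := by simp [hR]
      rw [hR0]
      have h1 := aux_cover v (v c) (⌊τ / v c⌋ * v c) (ffdBins v τ L) (by
        intro B hB
        have hB' := hbins B hB
        refine ⟨fun d hd => hv d (hB'.1 hd), ?_⟩
        obtain ⟨m, hm⟩ := aux_vol_multiple v M hfac c hc B hB'.1
        exact aux_le_floor _ _ _ (hv c hc) m hm
          ((aux_vol_le v _ B fun d hd => (hv d (hB'.1 hd)).le).trans hB'.2)) M
        (fun d hd => hffd.2 d ((hLM d).2 hd))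
      have h2 : ((ffdBins v τ L).length : ℚ) ≤ n := by exact_mod_cast hffd.1
      have := mul_le_mul_of_nonneg_right h2 (hfl0 c hc)
      push_cast
      linarith
    | succ k ih =>
      intro hk c hc
      have hkn : k < n := hk
      have ih := ih hkn.le
      have hkq : (0 : ℚ) ≤ n - (k + 1 : ℕ) := by
        have : ((k + 1 : ℕ) : ℚ) ≤ n := by exact_mod_cast hk
        linarith
      set K : Fin n := ⟨k, hkn⟩ with hK
      have hRK : remainingChores M Q K = R k := by
        simp only [remainingChores, hR, Fin.lt_def, hK]
      have hRs : R (k + 1) = R k \ Q K := by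
        ext d
        simp only [hR, Finset.mem_sdiff, Finset.mem_biUnion, Finset.mem_filter, Finset.mem_univ,
          true_and, not_exists, not_and]
        constructor
        · rintro ⟨h1, h2⟩
          exact ⟨⟨h1, fun j hj => h2 j (by omega)⟩, h2 K (by simp [hK])⟩
        · rintro ⟨⟨h1, h2⟩, h3⟩
          refine ⟨h1, fun j hj => ?_⟩
          rcases Nat.lt_succ_iff_lt_or_eq.1 hj with h | h
          · exact h2 j h
          · have : j = K := Fin.ext h
            rw [this]; exact h3
      have hQR : Q K ⊆ R k := by
        intro d hd
        simp only [hR, Finset.mem_sdiff, Finset.mem_biUnion, Finset.mem_filter, Finset.mem_univ,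
          true_and, not_exists, not_and]
        refine ⟨hQM K hd, fun j hj hdj => ?_⟩
        have hne : j ≠ K := by
          rintro rfl
          simp [hK] at hj
        exact Finset.disjoint_left.1 (hQd j K hne) hdj hd
      have hRM : R k ⊆ M := Finset.sdiff_subset
      -- the bundle takes enough
      have hfill : ∀ d ∈ R k \ Q K, ⌊τ / v d⌋ * v d ≤ auxVol v (v d) (Q K) := by
        intro d hd
        rw [Finset.mem_sdiff] at hd
        have hdM := hRM hd.1
        have hdp := hv d hdM
        by_contra hlt
        rw [not_le] at hlt
        obtain ⟨m, hm⟩ := aux_vol_multiple v M hfac d hdM (Q K) (hQM K)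
        rw [hm] at hlt
        have h1 : (m : ℚ) < ⌊τ / v d⌋ := lt_of_mul_lt_mul_right hlt hdp.le
        have h2 : m + 1 ≤ ⌊τ / v d⌋ := by
          have : m < ⌊τ / v d⌋ := by exact_mod_cast h1
          omega
        rw [Int.le_floor, le_div_iff₀ hdp] at h2
        push_cast at h2
        obtain ⟨B, hB⟩ := aux_exists_benchmark M Q v τ hτ K
        have h3 := hQ K B hB
        have h4 := hB.2.2 (insert d ((Q K).filter fun e => v d ≤ v e)) (by
          rw [hRK]
          exact Finset.insert_subset hd.1 ((Finset.filter_subset _ _).trans hQR)) (by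
          unfold bundleCost
          rw [Finset.sum_insert (by simp [hd.2])]
          unfold auxVol at hm
          rw [hm]
          linarith)
        refine aux_lex_lt v (Q K) d hd.2 hdp ?_
        unfold LexGe at h3 h4
        rw [aux_lexLe_iff] at h3 h4 ⊢
        exact h4.trans h3
      rw [hRs]
      by_cases hne : ((R k \ Q K).filter fun d => v c ≤ v d).Nonempty
      · obtain ⟨d, hd, hmin⟩ := Finset.exists_min_image _ v hne
        rw [Finset.mem_filter] at hd
        have hdM : d ∈ M := hRM (Finset.mem_sdiff.1 hd.1).1
        have e1 : auxVol v (v c) (R k \ Q K) = auxVol v (v d) (R k \ Q K) := by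
          unfold auxVol
          congr 1
          ext e
          simp only [Finset.mem_filter]
          constructor
          · rintro ⟨h1, h2⟩
            exact ⟨h1, hmin e (by rw [Finset.mem_filter]; exact ⟨h1, h2⟩)⟩
          · rintro ⟨h1, h2⟩
            exact ⟨h1, hd.2.trans h2⟩
        have e2 : auxVol v (v d) (R k) = auxVol v (v d) (R k \ Q K) + auxVol v (v d) (Q K) := by
          unfold auxVol
          rw [← Finset.sum_union, ← Finset.filter_union, Finset.sdiff_union_of_subset hQR]
          exact Finset.disjoint_filter_filter Finset.sdiff_disjoint
        have e3 := hfill d hd.1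
        have e4 := ih d hdM
        have e5 : ⌊τ / v d⌋ * v d ≤ ⌊τ / v c⌋ * v c := by
          obtain ⟨q, -, hq⟩ := hfac c hc d hdM hd.2
          refine aux_le_floor τ (v c) _ (hv c hc) (⌊τ / v d⌋ * q) ?_ ?_
          · push_cast
            rw [mul_assoc, ← hq]
          · rw [← le_div_iff₀ (hv d hdM)]
            exact Int.floor_le _
        have e6 := mul_le_mul_of_nonneg_left e5 hkq
        rw [e1]
        push_cast at e6 ⊢
        linarith
      · rw [Finset.not_nonempty_iff_eq_empty] at hne
        unfold auxVol
        rw [hne, Finset.sum_empty]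
        exact mul_nonneg hkq (hfl0 c hc)
  apply Finset.Subset.antisymm
  · intro d hd
    obtain ⟨k, -, hk⟩ := Finset.mem_biUnion.1 hd
    exact hQM k hk
  · intro d hd
    by_contra hnd
    have h1 := key n le_rfl d hd
    rw [sub_self, zero_mul] at h1
    have hdR : d ∈ R n := by
      simp only [hR, Finset.mem_sdiff, Finset.mem_biUnion, Finset.mem_filter, Finset.mem_univ,
        true_and, not_exists, not_and]
      refine ⟨hd, fun j _ hj => hnd ?_⟩
      exact Finset.mem_biUnion.2 ⟨j, Finset.mem_univ _, hj⟩
    have h2 : 0 < auxVol v (v d) (R n) := by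
      refine Finset.sum_pos (fun e he => ?_) ⟨d, by simp [hdR]⟩
      exact hv e (Finset.mem_sdiff.1 (Finset.mem_filter.1 he).1).1
    linarith
end

section
/- (Reduction Lemma for bivalued instances.) Let τ > 0 and let v be a bivalued cost function on a finite set M of chores. If FFD(M, v, τ) allocates all the chores into n bins, and (M, (Q_1,…,Q_n), v, τ) is a First Fit Valid tuple, then Q_1 ∪ … ∪ Q_n = M. -/
open Finset

variable {α : Type*} [DecidableEq α]

/-- `v` is bivalued on `M` with values `s < l`. -/
def Bivalued (v : α → ℚ) (M : Finset α) (s l : ℚ) : Prop :=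
  0 < s ∧ s < l ∧ ∀ c ∈ M, v c = s ∨ v c = l

/-- Total room for small chores in `m` bins when `a` large chores are packed first-fit. -/
def capC (p : ℕ) (f : ℕ → ℕ) : ℕ → ℕ → ℕ
  | 0, _ => 0
  | m + 1, a => f (min a p) + capC p f m (a - min a p)

theorem capC_pred (p d : ℕ) (f : ℕ → ℕ) (hf : ∀ a, a + 1 ≤ p → f (a + 1) + d ≤ f a)
    (m : ℕ) : ∀ a, a + 1 ≤ m * p → capC p f m (a + 1) + d ≤ capC p f m a := by
  induction m with
  | zero => intro a h; omega
  | succ m ih =>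
    intro a h
    rw [Nat.succ_mul] at h
    simp only [capC]
    by_cases hap : a + 1 ≤ p
    · rw [Nat.min_eq_left hap, Nat.min_eq_left (by omega : a ≤ p)]
      have := hf a hap
      simp only [Nat.sub_self]
      omega
    · rw [Nat.min_eq_right (by omega : p ≤ a + 1), Nat.min_eq_right (by omega : p ≤ a)]
      have h1 := ih (a - p) (by omega)
      rw [show a + 1 - p = a - p + 1 by omega]
      omega

theorem capC_anti (p d : ℕ) (f : ℕ → ℕ) (hf : ∀ a, a + 1 ≤ p → f (a + 1) + d ≤ f a)
    (m : ℕ) (a k : ℕ) (h : a + k ≤ m * p) : capC p f m (a + k) ≤ capC p f m a := by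
  induction k with
  | zero => simp
  | succ k ih =>
    have h1 := capC_pred p d f hf m (a + k) (by omega)
    have h2 := ih (by omega)
    rw [← Nat.add_assoc]
    omega

/-- One step of the invariant. -/
theorem fits_step (p d : ℕ) (f : ℕ → ℕ) (hf : ∀ a, a + 1 ≤ p → f (a + 1) + d ≤ f a)
    (hp : f p ≤ d) (m a b x y a' b' : ℕ) (ha : a ≤ (m + 1) * p) (hb : b ≤ capC p f (m + 1) a)
    (hx : a' + x = a) (hy : b' + y = b)
    (h : min a p < x ∨ (min a p = x ∧ min b (f (min a p)) ≤ y)) :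
    a' ≤ m * p ∧ b' ≤ capC p f m a' := by
  rw [Nat.succ_mul] at ha
  simp only [capC] at hb
  rcases h with h | ⟨h1, h2⟩
  · have hpa : p < a := by omega
    rw [Nat.min_eq_right hpa.le] at hb h
    refine ⟨by omega, ?_⟩
    have e1 := capC_pred p d f hf m (a - p - 1) (by omega)
    have e2 := capC_anti p d f hf m a' (x - p - 1) (by omega)
    rw [show a - p - 1 + 1 = a - p by omega] at e1
    rw [show a' + (x - p - 1) = a - p - 1 by omega] at e2
    omega
  · rw [h1] at hb h2
    refine ⟨by omega, ?_⟩
    rw [show a - x = a' by omega] at hb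
    omega

/-- Numeric first fit insertion. -/
def nIns (τ : ℚ) (w : ℚ) : List ℚ → List ℚ
  | [] => if w ≤ τ then [w] else []
  | x :: rest => if x + w ≤ τ then (x + w) :: rest else x :: nIns τ w rest

/-- Final load of a bin starting at load `x`. -/
def nLoad (τ : ℚ) : ℚ → List ℚ → ℚ
  | x, [] => x
  | x, w :: L => if x + w ≤ τ then nLoad τ (x + w) L else nLoad τ x L

/-- Items rejected by a bin starting at load `x`. -/
def nRej (τ : ℚ) : ℚ → List ℚ → List ℚ
  | _, [] => []
  | x, w :: L => if x + w ≤ τ then nRej τ (x + w) L else w :: nRej τ x L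

/-- Numeric first fit. -/
def nFF (τ : ℚ) (bins L : List ℚ) : List ℚ := L.foldl (fun b w => nIns τ w b) bins

theorem nFF_cons (τ : ℚ) (L : List ℚ) : ∀ x rest,
    nFF τ (x :: rest) L = nLoad τ x L :: nFF τ rest (nRej τ x L) := by
  induction L with
  | nil => intro x rest; simp [nFF, nLoad, nRej]
  | cons w L ih =>
    intro x rest
    have e : nFF τ (x :: rest) (w :: L) = nFF τ (nIns τ w (x :: rest)) L := rfl
    rw [e]
    by_cases h : x + w ≤ τ
    · simp only [nIns, nLoad, nRej, if_pos h, ih]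
    · simp only [nIns, nLoad, nRej, if_neg h, ih]
      rfl

theorem nFF_nil (τ : ℚ) (w : ℚ) (L : List ℚ) (hw : w ≤ τ) :
    nFF τ [] (w :: L) = nLoad τ 0 (w :: L) :: nFF τ [] (nRej τ 0 (w :: L)) := by
  have e : nFF τ [] (w :: L) = nFF τ (nIns τ w []) L := rfl
  rw [e]
  simp only [nIns, if_pos hw, nFF_cons, nLoad, nRej, zero_add]

theorem nRej_append (τ : ℚ) (L₁ L₂ : List ℚ) : ∀ x,
    nRej τ x (L₁ ++ L₂) = nRej τ x L₁ ++ nRej τ (nLoad τ x L₁) L₂ := by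
  induction L₁ with
  | nil => intro x; simp [nLoad, nRej]
  | cons w L ih =>
    intro x
    by_cases h : x + w ≤ τ
    · simp [nLoad, nRej, h, ih]
    · simp [nLoad, nRej, h, ih]

theorem floor_pred (τ x w : ℚ) (hw : 0 < w) :
    ⌊(τ - (x + w)) / w⌋₊ = ⌊(τ - x) / w⌋₊ - 1 := by
  rw [show (τ - (x + w)) / w = (τ - x) / w - 1 by field_simp; ring, Nat.floor_sub_one]

theorem rep_facts (τ w : ℚ) (hw : 0 < w) (k : ℕ) : ∀ x,
    nRej τ x (List.replicate k w) = List.replicate (k - min k ⌊(τ - x) / w⌋₊) w ∧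
    nLoad τ x (List.replicate k w) = x + (min k ⌊(τ - x) / w⌋₊ : ℕ) * w := by
  induction k with
  | zero => intro x; simp [nRej, nLoad]
  | succ k ih =>
    intro x
    have hfl : x + w ≤ τ ↔ 1 ≤ ⌊(τ - x) / w⌋₊ := by
      rw [Nat.le_floor_iff' one_ne_zero, le_div_iff₀ hw]
      push_cast
      constructor <;> intro h <;> linarith
    by_cases h : x + w ≤ τ
    · simp only [List.replicate_succ, nRej, nLoad, if_pos h]
      obtain ⟨h1, h2⟩ := ih (x + w)
      rw [h1, h2, floor_pred τ x w hw]
      have := hfl.1 h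
      constructor
      · congr 1; omega
      · have e : min (k + 1) ⌊(τ - x) / w⌋₊ = min k (⌊(τ - x) / w⌋₊ - 1) + 1 := by omega
        rw [e]; push_cast; ring
    · simp only [List.replicate_succ, nRej, nLoad, if_neg h]
      obtain ⟨h1, h2⟩ := ih x
      rw [h1, h2]
      have h0 : ⌊(τ - x) / w⌋₊ = 0 := by
        by_contra hne; exact h (hfl.2 (by omega))
      rw [h0]
      simp [List.replicate_succ]

/-- Room for small chores next to `x` large ones. -/
def room (τ s l : ℚ) (x : ℕ) : ℕ := ⌊(τ - x * l) / s⌋₊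

theorem nFF_fits (τ s l : ℚ) (hs : 0 < s) (hsl : s < l) (n : ℕ) : ∀ a b : ℕ,
    (∀ w ∈ List.replicate a l ++ List.replicate b s, w ≤ τ) →
    (nFF τ [] (List.replicate a l ++ List.replicate b s)).length ≤ n →
    a ≤ n * ⌊τ / l⌋₊ ∧ b ≤ capC ⌊τ / l⌋₊ (room τ s l) n a := by
  induction n with
  | zero =>
    intro a b hw hn
    rcases hE : List.replicate a l ++ List.replicate b s with _ | ⟨w, L⟩
    · simp at hE; simp [hE]
    · rw [hE] at hw hn
      rw [nFF_nil τ w L (hw w (by simp))] at hn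
      simp at hn
  | succ n ih =>
    intro a b hw hn
    rcases hE : List.replicate a l ++ List.replicate b s with _ | ⟨w, L⟩
    · simp at hE; simp [hE]
    · have hw' := hw
      rw [hE] at hn hw
      rw [nFF_nil τ w L (hw w (by simp)), ← hE] at hn
      rw [List.length_cons, nRej_append, (rep_facts τ l (hs.trans hsl) a 0).1,
        (rep_facts τ l (hs.trans hsl) a 0).2, (rep_facts τ s hs b _).1] at hn
      simp only [sub_zero, zero_add] at hn
      obtain ⟨h1, h2⟩ := ih _ _ (by
        intro w hw2
        apply hw'
        simp only [List.mem_append, List.mem_replicate] at hw2 ⊢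
        rcases hw2 with ⟨h, h'⟩ | ⟨h, h'⟩
        · exact Or.inl ⟨by omega, h'⟩
        · exact Or.inr ⟨by omega, h'⟩) (Nat.le_of_succ_le_succ hn)
      rw [Nat.succ_mul]
      refine ⟨by omega, ?_⟩
      simp only [capC]
      have : room τ s l (min a ⌊τ / l⌋₊) = ⌊(τ - ((min a ⌊τ / l⌋₊ : ℕ) : ℚ) * l) / s⌋₊ := rfl
      rw [this]
      omega

theorem map_ffdInsert (v : α → ℚ) (τ : ℚ) (c : α) (bins : List (Finset α))
    (h : ∀ B ∈ bins, c ∉ B) :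
    (ffdInsert v τ c bins).map (bundleCost v) = nIns τ (v c) (bins.map (bundleCost v)) := by
  induction bins with
  | nil => by_cases h : v c ≤ τ <;> simp [ffdInsert, nIns, h, bundleCost]
  | cons B rest ih =>
    have hc : c ∉ B := h B (by simp)
    have hr := ih (fun B hB => h B (by simp [hB]))
    by_cases h : bundleCost v B + v c ≤ τ
    · simp only [ffdInsert, nIns, h, if_true, List.map_cons]
      congr 1
      simp only [bundleCost, Finset.sum_insert hc]; ring
    · simp only [ffdInsert, nIns, h, if_false, List.map_cons, hr]

theorem mem_ffdInsert (v : α → ℚ) (τ : ℚ) (c : α) (bins : List (Finset α)) :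
    ∀ B ∈ ffdInsert v τ c bins, ∀ x ∈ B, x = c ∨ ∃ B' ∈ bins, x ∈ B' := by
  induction bins with
  | nil =>
    by_cases h : v c ≤ τ <;> simp [ffdInsert, h]
  | cons B rest ih =>
    by_cases h : bundleCost v B + v c ≤ τ
    · simp only [ffdInsert, h, if_true]
      intro B1 hB1 x hx
      rcases List.mem_cons.1 hB1 with rfl | hB1
      · rcases Finset.mem_insert.1 hx with rfl | hx
        · exact Or.inl rfl
        · exact Or.inr ⟨B, by simp, hx⟩
      · exact Or.inr ⟨B1, by simp [hB1], hx⟩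
    · simp only [ffdInsert, h, if_false]
      intro B1 hB1 x hx
      rcases List.mem_cons.1 hB1 with rfl | hB1
      · exact Or.inr ⟨B1, by simp, hx⟩
      · rcases ih B1 hB1 x hx with h | ⟨B', hB', h⟩
        · exact Or.inl h
        · exact Or.inr ⟨B', by simp [hB'], h⟩

theorem le_ffdInsert (v : α → ℚ) (τ : ℚ) (c : α) (hc : 0 < v c) (bins : List (Finset α))
    (hb : ∀ B ∈ bins, ∀ x ∈ B, 0 < v x ∧ v x ≤ τ) :
    ∀ B ∈ ffdInsert v τ c bins, ∀ x ∈ B, 0 < v x ∧ v x ≤ τ := by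
  induction bins with
  | nil =>
    by_cases h : v c ≤ τ <;> simp [ffdInsert, h, hc]
  | cons B rest ih =>
    by_cases h : bundleCost v B + v c ≤ τ
    · simp only [ffdInsert, h, if_true]
      intro B1 hB1 x hx
      rcases List.mem_cons.1 hB1 with rfl | hB1
      · rcases Finset.mem_insert.1 hx with rfl | hx
        · have : 0 ≤ bundleCost v B :=
            Finset.sum_nonneg (fun y hy => (hb B (by simp) y hy).1.le)
          exact ⟨hc, by linarith⟩
        · exact hb B (by simp) x hx
      · exact hb B1 (by simp [hB1]) x hx
    · simp only [ffdInsert, h, if_false]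
      intro B1 hB1 x hx
      rcases List.mem_cons.1 hB1 with rfl | hB1
      · exact hb B1 (by simp) x hx
      · exact ih (fun B hB => hb B (by simp [hB])) B1 hB1 x hx

theorem foldl_facts (v : α → ℚ) (τ : ℚ) (L : List α) : ∀ (bins : List (Finset α)),
    L.Nodup → (∀ c ∈ L, 0 < v c) → (∀ B ∈ bins, ∀ x ∈ B, x ∉ L) →
    (∀ B ∈ bins, ∀ x ∈ B, 0 < v x ∧ v x ≤ τ) →
    (L.foldl (fun bins c => ffdInsert v τ c bins) bins).map (bundleCost v)
      = nFF τ (bins.map (bundleCost v)) (L.map v) ∧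
    ∀ B ∈ L.foldl (fun bins c => ffdInsert v τ c bins) bins, ∀ x ∈ B, 0 < v x ∧ v x ≤ τ := by
  induction L with
  | nil => intro bins _ _ _ h; exact ⟨rfl, h⟩
  | cons c L ih =>
    intro bins hnd hpos hdis hle
    have hc := List.nodup_cons.1 hnd
    obtain ⟨h1, h2⟩ := ih (ffdInsert v τ c bins) hc.2 (fun x hx => hpos x (by simp [hx]))
      (by
        intro B hB x hx
        rcases mem_ffdInsert v τ c bins B hB x hx with rfl | ⟨B', hB', hx'⟩
        · exact hc.1
        · intro hxL; exact hdis B' hB' x hx' (by simp [hxL]))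
      (le_ffdInsert v τ c (hpos c (by simp)) bins hle)
    refine ⟨?_, h2⟩
    rw [List.foldl_cons, h1, map_ffdInsert v τ c bins (fun B hB hcB => hdis B hB c hcB (by simp))]
    rfl

/-- Number of chores of cost `w`. -/
def cnt (v : α → ℚ) (w : ℚ) (S : Finset α) : ℕ := (S.filter fun c => v c = w).card

theorem map_val (v : α → ℚ) (s l : ℚ) (hsl : s < l) (B : Finset α)
    (hB : ∀ c ∈ B, v c = s ∨ v c = l) :
    B.val.map v = Multiset.replicate (cnt v l B) l + Multiset.replicate (cnt v s B) s := by
  induction B using Finset.induction_on with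
  | empty => simp [cnt]
  | insert c B hc ih =>
    have ih := ih (fun x hx => hB x (by simp [hx]))
    rw [Finset.insert_val_of_notMem hc, Multiset.map_cons, ih]
    rcases hB c (by simp) with h | h
    · have e1 : cnt v s (insert c B) = cnt v s B + 1 := by
        simp [cnt, Finset.filter_insert, h, hc]
      have e2 : cnt v l (insert c B) = cnt v l B := by
        simp [cnt, Finset.filter_insert, h, hsl.ne]
      rw [e1, e2, h]; simp [Multiset.replicate_succ]
    · have e1 : cnt v s (insert c B) = cnt v s B := by
        simp [cnt, Finset.filter_insert, h, hsl.ne']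
      have e2 : cnt v l (insert c B) = cnt v l B + 1 := by
        simp [cnt, Finset.filter_insert, h, hc]
      rw [e1, e2, h]; simp [Multiset.replicate_succ]

theorem cost_eq (v : α → ℚ) (s l : ℚ) (hsl : s < l) (B : Finset α)
    (hB : ∀ c ∈ B, v c = s ∨ v c = l) :
    bundleCost v B = cnt v l B * l + cnt v s B * s := by
  have : bundleCost v B = (B.val.map v).sum := rfl
  rw [this, map_val v s l hsl B hB]
  simp

theorem list_eq (s l : ℚ) (hsl : s < l) (x y : ℕ) (L : List ℚ)
    (hs : L.Pairwise (fun c c' => c' ≤ c))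
    (h : (L : Multiset ℚ) = Multiset.replicate x l + Multiset.replicate y s) :
    L = List.replicate x l ++ List.replicate y s := by
  have hp : L.Perm (List.replicate x l ++ List.replicate y s) := by
    rw [← Multiset.coe_eq_coe, h, ← Multiset.coe_add, Multiset.coe_replicate,
      Multiset.coe_replicate]
  refine List.Perm.eq_of_pairwise (le := fun c c' => c' ≤ c) ?_ hs ?_ hp
  · intro a b _ _ h1 h2; exact le_antisymm h2 h1
  · rw [List.pairwise_append]
    refine ⟨by simp [List.pairwise_replicate], by simp [List.pairwise_replicate], ?_⟩
    intro a ha b hb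
    rw [(List.mem_replicate.1 ha).2, (List.mem_replicate.1 hb).2]; exact hsl.le

theorem costSeq_eq (v : α → ℚ) (s l : ℚ) (hsl : s < l) (B : Finset α)
    (hB : ∀ c ∈ B, v c = s ∨ v c = l) (q : ℕ) :
    costSeq v B q = if q < cnt v l B then l else if q < cnt v l B + cnt v s B then s else 0 := by
  have h : ((B.val.map v).sort (· ≤ ·)).reverse
      = List.replicate (cnt v l B) l ++ List.replicate (cnt v s B) s := by
    apply list_eq s l hsl
    · rw [List.pairwise_reverse]
      exact Multiset.pairwise_sort _ _
    · rw [Multiset.coe_reverse, Multiset.sort_eq, map_val v s l hsl B hB]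
  rw [costSeq, h]
  simp only [List.getD_eq_getElem?_getD, List.getElem?_append, List.length_replicate,
    List.getElem?_replicate]
  split_ifs <;> first | rfl | omega

theorem lexLe_iff (v : α → ℚ) (s l : ℚ) (hs : 0 < s) (hsl : s < l) (B₁ B₂ : Finset α)
    (h1 : ∀ c ∈ B₁, v c = s ∨ v c = l) (h2 : ∀ c ∈ B₂, v c = s ∨ v c = l) :
    LexLe v B₁ B₂ ↔ cnt v l B₁ < cnt v l B₂ ∨
      (cnt v l B₁ = cnt v l B₂ ∧ cnt v s B₁ ≤ cnt v s B₂) := by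
  have key : ∀ x y x' y' q : ℕ,
      ((if q < x then l else if q < x + y then s else 0) : ℚ)
        < (if q < x' then l else if q < x' + y' then s else 0) →
      (x ≤ q ∧ q < x') ∨ (x' ≤ q ∧ x + y ≤ q ∧ q < x' + y') := by
    intro x y x' y' q h
    split_ifs at h <;> first | omega | (exfalso; linarith)
  have key2 : ∀ x y x' y' q : ℕ, (x ≤ q ∧ q < x') ∨ (x' ≤ q ∧ x + y ≤ q ∧ q < x' + y') →
      ((if q < x then l else if q < x + y then s else 0) : ℚ)
        < (if q < x' then l else if q < x' + y' then s else 0) := by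
    intro x y x' y' q h
    split_ifs <;> first | omega | linarith
  simp only [LexLe, LexEq, costSeq_eq v s l hsl B₁ h1, costSeq_eq v s l hsl B₂ h2]
  generalize cnt v l B₁ = x
  generalize cnt v l B₂ = x'
  generalize cnt v s B₁ = y
  generalize cnt v s B₂ = y'
  constructor
  · intro h
    by_contra hcon
    -- then `(x', y')` is strictly smaller; find the first difference
    have hc : x' < x ∨ (x' = x ∧ y' < y) := by omega
    have : ∃ q₀, (∀ p < q₀, ((if p < x then l else if p < x + y then s else 0) : ℚ)
        ≥ (if p < x' then l else if p < x' + y' then s else 0)) ∧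
        (∀ p, q₀ ≤ p → ¬ (x ≤ p ∧ p < x')) ∧
        ((if q₀ < x' then l else if q₀ < x' + y' then s else 0) : ℚ)
          < (if q₀ < x then l else if q₀ < x + y then s else 0) := by
      rcases hc with hc | ⟨rfl, hc⟩
      · refine ⟨x', ?_, by intro p hp; omega, key2 _ _ _ _ _ (by omega)⟩
        intro p hp
        by_contra hlt
        have := key _ _ _ _ _ (not_le.1 hlt)
        omega
      · refine ⟨x' + y', ?_, by intro p hp; omega, key2 _ _ _ _ _ (by omega)⟩
        intro p hp
        by_contra hlt
        have := key _ _ _ _ _ (not_le.1 hlt)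
        omega
    obtain ⟨q₀, ha, _, hb⟩ := this
    rcases h with h | ⟨q, hq1, hq2⟩
    · rw [h q₀] at hb; exact lt_irrefl _ hb
    · rcases lt_trichotomy q q₀ with hq | rfl | hq
      · exact absurd hq2 (not_lt.2 (ha q hq))
      · exact lt_asymm hb hq2
      · rw [hq1 q₀ hq] at hb; exact lt_irrefl _ hb
  · intro h
    rcases h with h | ⟨rfl, h⟩
    · right
      refine ⟨x, ?_, key2 _ _ _ _ _ (by omega)⟩
      intro p hp
      rw [if_pos hp, if_pos (by omega)]
    · rcases h.lt_or_eq with h | rfl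
      · right
        refine ⟨x + y, ?_, key2 _ _ _ _ _ (by omega)⟩
        intro p hp
        split_ifs <;> first | rfl | omega
      · left; intro p; rfl

theorem cnt_mono (v : α → ℚ) (w : ℚ) {S T : Finset α} (h : S ⊆ T) : cnt v w S ≤ cnt v w T :=
  Finset.card_le_card (Finset.filter_subset_filter _ h)

theorem cnt_sdiff (v : α → ℚ) (w : ℚ) {S T : Finset α} (h : S ⊆ T) :
    cnt v w (T \ S) + cnt v w S = cnt v w T := by
  unfold cnt
  rw [← Finset.card_sdiff_add_card_eq_card (Finset.filter_subset_filter (fun c => v c = w) h)]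
  congr 2
  ext c
  simp only [Finset.mem_filter, Finset.mem_sdiff]
  tauto

theorem exists_sub (v : α → ℚ) (s l : ℚ) (hsl : s < l) (R : Finset α) (x y : ℕ)
    (hx : x ≤ cnt v l R) (hy : y ≤ cnt v s R) :
    ∃ B ⊆ R, cnt v l B = x ∧ cnt v s B = y := by
  obtain ⟨X, hX, hXc⟩ := Finset.exists_subset_card_eq hx
  obtain ⟨Y, hY, hYc⟩ := Finset.exists_subset_card_eq hy
  have hXl : ∀ c ∈ X, v c = l := fun c hc => (Finset.mem_filter.1 (hX hc)).2
  have hYs : ∀ c ∈ Y, v c = s := fun c hc => (Finset.mem_filter.1 (hY hc)).2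
  refine ⟨X ∪ Y, Finset.union_subset (hX.trans (Finset.filter_subset _ _))
    (hY.trans (Finset.filter_subset _ _)), ?_, ?_⟩
  · rw [← hXc]; unfold cnt; congr 1; ext c
    simp only [Finset.mem_filter, Finset.mem_union]
    constructor
    · rintro ⟨h | h, h'⟩
      · exact h
      · have := hYs c h; linarith
    · intro h; exact ⟨Or.inl h, hXl c h⟩
  · rw [← hYc]; unfold cnt; congr 1; ext c
    simp only [Finset.mem_filter, Finset.mem_union]
    constructor
    · rintro ⟨h | h, h'⟩
      · have := hXl c h; linarith
      · exact h
    · intro h; exact ⟨Or.inr h, hYs c h⟩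

/-- Existence of the benchmark bundle, with explicit counts. -/
theorem exists_benchmark (v : α → ℚ) (s l : ℚ) (hs : 0 < s) (hsl : s < l) (τ : ℚ) (hτ : 0 < τ)
    (R : Finset α) (hR : ∀ c ∈ R, v c = s ∨ v c = l) :
    ∃ B ⊆ R, bundleCost v B ≤ τ ∧ (∀ B' ⊆ R, bundleCost v B' ≤ τ → LexGe v B B') ∧
      cnt v l B = min (cnt v l R) ⌊τ / l⌋₊ ∧
      cnt v s B = min (cnt v s R) (room τ s l (min (cnt v l R) ⌊τ / l⌋₊)) := by
  have hl : 0 < l := hs.trans hsl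
  obtain ⟨B, hBR, hx, hy⟩ := exists_sub v s l hsl R (min (cnt v l R) ⌊τ / l⌋₊)
    (min (cnt v s R) (room τ s l (min (cnt v l R) ⌊τ / l⌋₊)))
    (Nat.min_le_left _ _) (Nat.min_le_left _ _)
  refine ⟨B, hBR, ?_, ?_, hx, hy⟩
  · rw [cost_eq v s l hsl B (fun c hc => hR c (hBR hc))]
    have h1 : (cnt v l B : ℚ) * l ≤ τ := by
      have : cnt v l B ≤ ⌊τ / l⌋₊ := by omega
      have h := (Nat.le_floor_iff (by positivity)).1 this
      rwa [le_div_iff₀ hl] at h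
    have h2 : cnt v s B ≤ room τ s l (cnt v l B) := by rw [hx]; omega
    have h3 := (Nat.le_floor_iff (div_nonneg (by linarith) hs.le)).1 h2
    rw [le_div_iff₀ hs] at h3
    linarith
  · intro B' hB' hc
    have hbv' : ∀ c ∈ B', v c = s ∨ v c = l := fun c hc => hR c (hB' hc)
    rw [LexGe, lexLe_iff v s l hs hsl B' B hbv' (fun c hc => hR c (hBR hc)), hx, hy]
    rw [cost_eq v s l hsl B' hbv'] at hc
    have n1 : (0 : ℚ) ≤ cnt v l B' * l := by positivity
    have n2 : (0 : ℚ) ≤ cnt v s B' * s := by positivity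
    have h1 : cnt v l B' ≤ ⌊τ / l⌋₊ := Nat.le_floor (by rw [le_div_iff₀ hl]; linarith)
    have h2 : cnt v s B' ≤ room τ s l (cnt v l B') :=
      Nat.le_floor (by rw [le_div_iff₀ hs]; linarith)
    have h3 := cnt_mono v l hB'
    have h4 := cnt_mono v s hB'
    have h5 : cnt v l B' ≤ min (cnt v l R) ⌊τ / l⌋₊ := by omega
    rcases h5.lt_or_eq with h | h
    · exact Or.inl h
    · rw [h] at h2; exact Or.inr ⟨h, by omega⟩

theorem room_pred (τ s l : ℚ) (hs : 0 < s) (hsl : s < l) (a : ℕ) (h : a + 1 ≤ ⌊τ / l⌋₊) :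
    room τ s l (a + 1) + ⌊l / s⌋₊ ≤ room τ s l a := by
  have hl : 0 < l := hs.trans hsl
  have h1 := (Nat.le_floor_iff' (Nat.succ_ne_zero a)).1 h
  rw [le_div_iff₀ hl] at h1
  apply Nat.le_floor
  have e1 := Nat.floor_le (show 0 ≤ (τ - ((a + 1 : ℕ) : ℚ) * l) / s from
    div_nonneg (by linarith) hs.le)
  have e2 := Nat.floor_le (show 0 ≤ l / s by positivity)
  unfold room
  push_cast at e1 ⊢
  calc _ ≤ (τ - (a + 1) * l) / s + l / s := add_le_add e1 e2
    _ = (τ - a * l) / s := by field_simp; ring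

theorem room_p (τ s l : ℚ) (hs : 0 < s) (hsl : s < l) :
    room τ s l ⌊τ / l⌋₊ ≤ ⌊l / s⌋₊ := by
  have hl : 0 < l := hs.trans hsl
  apply Nat.floor_le_floor
  have h := Nat.lt_floor_add_one (τ / l)
  rw [div_lt_iff₀ hl] at h
  apply div_le_div_of_nonneg_right _ hs.le
  linarith


/-- Reduction Lemma for bivalued instances: if FFD allocates all chores
into `n` bins and `(M, Q, v, τ)` is First Fit Valid, then `Q` contains all chores. -/
theorem reduction_lemma_bivalued
    (M : Finset α) (v : α → ℚ) (s l : ℚ) (hbv : Bivalued v M s l)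
    (τ : ℚ) (hτ : 0 < τ)
    (n : ℕ) (L : List α) (hL : IsFFDList v M L)
    (hffd : FFDAllocatesInto v τ L n)
    (Q : Fin n → Finset α) (hffv : FirstFitValid M Q v τ) :
    Finset.univ.biUnion Q = M := by
  
  obtain ⟨hs, hsl, hv⟩ := hbv
  obtain ⟨hLM, hnd, hsort⟩ := hL
  obtain ⟨hlen, hall⟩ := hffd
  obtain ⟨hQM, hQd, hQb⟩ := hffv
  have hl : 0 < l := hs.trans hsl
  have hmem : ∀ c, c ∈ L ↔ c ∈ M := by intro c; rw [← hLM]; simp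
  have hpos : ∀ c ∈ L, 0 < v c := by
    intro c hc
    rcases hv c ((hmem c).1 hc) with h | h <;> rw [h] <;> assumption
  obtain ⟨f1, f2⟩ := foldl_facts v τ L [] hnd hpos (by simp) (by simp)
  have hle : ∀ c ∈ L, v c ≤ τ := by
    intro c hc
    obtain ⟨B, hB, hcB⟩ := hall c hc
    exact (f2 B hB c hcB).2
  have hLv : L.map v = List.replicate (cnt v l M) l ++ List.replicate (cnt v s M) s := by
    apply list_eq s l hsl
    · rw [List.pairwise_map]; exact hsort
    · rw [← map_val v s l hsl M hv, ← hLM, List.toFinset_val, hnd.dedup, Multiset.map_coe]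
  have hfit := nFF_fits τ s l hs hsl n (cnt v l M) (cnt v s M)
    (by
      rw [← hLv]; intro w hw
      obtain ⟨c, hc, rfl⟩ := List.mem_map.1 hw
      exact hle c hc)
    (by
      rw [← hLv]
      have := congrArg List.length f1
      rw [List.length_map, List.map_nil] at this
      rw [← this]; exact hlen)
  have main : ∀ k, k ≤ n →
      cnt v l (M \ (Finset.univ.filter fun j : Fin n => j.val < k).biUnion Q)
        ≤ (n - k) * ⌊τ / l⌋₊ ∧
      cnt v s (M \ (Finset.univ.filter fun j : Fin n => j.val < k).biUnion Q)
        ≤ capC ⌊τ / l⌋₊ (room τ s l) (n - k)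
          (cnt v l (M \ (Finset.univ.filter fun j : Fin n => j.val < k).biUnion Q)) := by
    intro k
    induction k with
    | zero => intro _; simpa using hfit
    | succ k ih =>
      intro hk
      obtain ⟨h1, h2⟩ := ih (by omega)
      set R := M \ (Finset.univ.filter fun j : Fin n => j.val < k).biUnion Q with hRdef
      let K : Fin n := ⟨k, hk⟩
      have hRK : remainingChores M Q K = R := rfl
      have hQR : Q K ⊆ R := by
        intro c hc
        rw [hRdef, Finset.mem_sdiff]
        refine ⟨hQM K hc, ?_⟩
        intro hc'
        obtain ⟨j, hj, hcj⟩ := Finset.mem_biUnion.1 hc'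
        have hjk : j.val < k := (Finset.mem_filter.1 hj).2
        have hne : j ≠ K := by intro e; rw [e] at hjk; exact lt_irrefl _ hjk
        exact Finset.disjoint_left.1 (hQd j K hne) hcj hc
      have hR' : M \ (Finset.univ.filter fun j : Fin n => j.val < k + 1).biUnion Q = R \ Q K := by
        ext c
        simp only [hRdef, Finset.mem_sdiff, Finset.mem_biUnion, Finset.mem_filter,
          Finset.mem_univ, true_and, not_exists, not_and]
        constructor
        · rintro ⟨a, b⟩
          exact ⟨⟨a, fun j hj => b j (by omega)⟩, b K (Nat.lt_succ_self k)⟩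
        · rintro ⟨⟨a, b⟩, e⟩
          refine ⟨a, fun j hj => ?_⟩
          rcases Nat.lt_succ_iff_lt_or_eq.1 hj with h | h
          · exact b j h
          · have : j = K := Fin.ext h
            rw [this]; exact e
      have hRM : R ⊆ M := Finset.sdiff_subset
      have hRv : ∀ c ∈ R, v c = s ∨ v c = l := fun c hc => hv c (hRM hc)
      obtain ⟨B, hBR, hB1, hB2, hBx, hBy⟩ := exists_benchmark v s l hs hsl τ hτ R hRv
      have hlex := hQb K B ⟨hBR, hB1, hB2⟩
      rw [LexGe, lexLe_iff v s l hs hsl B (Q K) (fun c hc => hRv c (hBR hc))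
        (fun c hc => hRv c (hQR hc)), hBx, hBy] at hlex
      rw [hR']
      rw [show n - k = (n - (k + 1)) + 1 by omega] at h1 h2
      exact fits_step _ ⌊l / s⌋₊ _ (room_pred τ s l hs hsl) (room_p τ s l hs hsl) _ _ _ _ _ _ _
        h1 h2 (cnt_sdiff v l hQR) (cnt_sdiff v s hQR) hlex
  obtain ⟨m1, m2⟩ := main n le_rfl
  have hfil : (Finset.univ.filter fun j : Fin n => j.val < n) = Finset.univ := by
    ext j; simp
  rw [hfil] at m1 m2
  rw [Nat.sub_self] at m1 m2
  rw [Nat.zero_mul] at m1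
  simp only [capC] at m2
  apply Finset.Subset.antisymm
  · intro c hc
    obtain ⟨j, _, hj⟩ := Finset.mem_biUnion.1 hc
    exact hQM j hj
  · intro c hc
    by_contra hcn
    have hcR : c ∈ M \ Finset.univ.biUnion Q := Finset.mem_sdiff.2 ⟨hc, hcn⟩
    rcases hv c hc with h | h
    · have : 0 < cnt v s (M \ Finset.univ.biUnion Q) :=
        Finset.card_pos.2 ⟨c, Finset.mem_filter.2 ⟨hcR, h⟩⟩
      omega
    · have : 0 < cnt v l (M \ Finset.univ.biUnion Q) :=
        Finset.card_pos.2 ⟨c, Finset.mem_filter.2 ⟨hcR, h⟩⟩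
      omega
end

section
/- Consider an IDO chore instance with n agents in which every cost function v_i is factored or every cost function v_i is bivalued. Let τ_1,…,τ_n > 0 be thresholds such that for every agent i, FFD(M, v_i, τ_i) allocates all chores into n bins. Then HFFD run with thresholds (τ_1,…,τ_n) allocates all chores, and each agent i receives a bundle whose v_i-cost is at most τ_i. -/
open Finset

variable {α : Type*} [DecidableEq α]

theorem exists_weight_lt (n : ℕ) (M : Finset α) (A B : ℕ → Finset α) (c : α) (w : α → ℚ)
    (hw : ∀ x ∈ M, 0 ≤ w x) (hc : c ∈ M) (hwc : 0 < w c)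
    (hAM : ∀ k < n, A k ⊆ M) (hcov : ∀ x ∈ M, ∃ k < n, x ∈ A k)
    (hBM : ∀ k < n, B k ⊆ M) (hdis : ∀ k t, k < t → t < n → Disjoint (B k) (B t))
    (hcB : ∀ k < n, c ∉ B k) :
    ∃ k < n, ∑ x ∈ B k, w x < ∑ x ∈ A k, w x := by
  by_contra! h
  have h1 : ∑ x ∈ M, w x ≤ ∑ k ∈ range n, ∑ x ∈ A k, w x := by
    have hind : ∀ k ∈ range n, ∑ x ∈ A k, w x = ∑ x ∈ M, if x ∈ A k then w x else 0 := by
      intro k hk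
      rw [← Finset.sum_filter, Finset.filter_mem_eq_inter,
        Finset.inter_eq_right.2 (hAM k (mem_range.1 hk))]
    rw [Finset.sum_congr rfl hind, Finset.sum_comm]
    apply Finset.sum_le_sum
    intro x hx
    obtain ⟨k, hk, hxk⟩ := hcov x hx
    have := Finset.single_le_sum (f := fun k => if x ∈ A k then w x else 0) (s := range n)
      (fun j _ => by
        split_ifs
        · exact hw x hx
        · exact le_rfl) (mem_range.2 hk)
    simpa [hxk] using this
  have h2 : w c + ∑ k ∈ range n, ∑ x ∈ B k, w x ≤ ∑ x ∈ M, w x := by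
    have hpd : Set.PairwiseDisjoint (↑(range n)) B := by
      intro k hk t ht hkt
      simp only [coe_range, Set.mem_Iio] at hk ht
      rcases lt_or_gt_of_ne hkt with h' | h'
      · exact hdis k t h' ht
      · exact (hdis t k h' hk).symm
    rw [← Finset.sum_biUnion hpd, ← Finset.sum_insert]
    · apply Finset.sum_le_sum_of_subset_of_nonneg
      · intro x hx
        rcases Finset.mem_insert.1 hx with rfl | hx
        · exact hc
        · obtain ⟨k, hk, hxk⟩ := Finset.mem_biUnion.1 hx
          exact hBM k (mem_range.1 hk) hxk
      · intro x hx _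
        exact hw x hx
    · intro hx
      obtain ⟨k, hk, hxk⟩ := Finset.mem_biUnion.1 hx
      exact hcB k (mem_range.1 hk) hxk
  have h3 : ∑ k ∈ range n, ∑ x ∈ A k, w x ≤ ∑ k ∈ range n, ∑ x ∈ B k, w x :=
    Finset.sum_le_sum fun k hk => h k (mem_range.1 hk)
  linarith

/-- A sum of positive integer multiples of `u` is a natural multiple of `u`. -/
theorem sum_multiple (v : α → ℚ) (u : ℚ) (S : Finset α)
    (h : ∀ x ∈ S, ∃ q : ℕ, v x = q * u) : ∃ N : ℕ, ∑ x ∈ S, v x = N * u := by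
  induction S using Finset.induction_on with
  | empty => exact ⟨0, by simp⟩
  | insert a S ha ih =>
    obtain ⟨N, hN⟩ := ih fun x hx => h x (Finset.mem_insert_of_mem hx)
    obtain ⟨q, hq⟩ := h a (Finset.mem_insert_self _ _)
    exact ⟨q + N, by rw [Finset.sum_insert ha, hN, hq]; push_cast; ring⟩

theorem core_multiple (n : ℕ) (M : Finset α) (A B : ℕ → Finset α) (c : α) (v : α → ℚ) (τ : ℚ)
    (hpos : ∀ x ∈ M, 0 < v x) (hc : c ∈ M)
    (hAM : ∀ k < n, A k ⊆ M) (hcov : ∀ x ∈ M, ∃ k < n, x ∈ A k)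
    (hAτ : ∀ k < n, ∑ x ∈ A k, v x ≤ τ)
    (hBM : ∀ k < n, B k ⊆ M) (hdis : ∀ k t, k < t → t < n → Disjoint (B k) (B t))
    (hcB : ∀ k < n, c ∉ B k)
    (hB : ∀ k < n, τ < ∑ x ∈ B k with v c ≤ v x, v x + v c)
    (hmul : ∀ x ∈ M, v c ≤ v x → ∃ q : ℕ, v x = q * v c) : False := by
  have hc0 := hpos c hc
  obtain ⟨k, hk, hlt⟩ := exists_weight_lt n M A B c (fun x => if v c ≤ v x then v x else 0)
    (fun x hx => by
      split_ifs
      · exact (hpos x hx).le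
      · exact le_rfl) hc (by simpa using hc0) hAM hcov hBM hdis hcB
  rw [← Finset.sum_filter, ← Finset.sum_filter] at hlt
  obtain ⟨N, hN⟩ := sum_multiple v (v c) ((B k).filter fun x => v c ≤ v x) (by
    intro x hx
    rw [Finset.mem_filter] at hx
    exact hmul x (hBM k hk hx.1) hx.2)
  obtain ⟨N', hN'⟩ := sum_multiple v (v c) ((A k).filter fun x => v c ≤ v x) (by
    intro x hx
    rw [Finset.mem_filter] at hx
    exact hmul x (hAM k hk hx.1) hx.2)
  have h1 := hB k hk
  have h2 : ∑ x ∈ A k with v c ≤ v x, v x ≤ τ := by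
    refine le_trans ?_ (hAτ k hk)
    apply Finset.sum_le_sum_of_subset_of_nonneg (Finset.filter_subset _ _)
    intro x hx _
    exact (hpos x (hAM k hk hx)).le
  rw [hN, hN'] at hlt
  rw [hN] at h1
  rw [hN'] at h2
  have h3 : (N : ℚ) < N' := lt_of_mul_lt_mul_right hlt hc0.le
  have h4 : (N' : ℚ) * v c < (N + 1 : ℚ) * v c := by linarith
  have h5 : (N' : ℚ) < N + 1 := lt_of_mul_lt_mul_right h4 hc0.le
  have h6 : N < N' := by exact_mod_cast h3
  have h7 : N' < N + 1 := by exact_mod_cast h5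
  omega

theorem bival_pointwise (s l τ : ℚ) (hs : 0 < s) (hsl : s < l) (i m j m' : ℕ)
    (h1 : i * l + m * s ≤ τ) (h2 : τ < j * l + m' * s + s)
    (h3 : i < j → τ < (i + 1) * l) :
    m + ⌊l / s⌋₊ * i ≤ m' + ⌊l / s⌋₊ * j := by
  set d := ⌊l / s⌋₊ with hd
  have hds : (d : ℚ) * s ≤ l := by
    have := Nat.floor_le (a := l / s) (div_nonneg (by linarith) hs.le)
    rwa [le_div_iff₀ hs] at this
  rcases lt_or_ge i j with hij | hij
  · have h4 := h3 hij
    have hm : m ≤ d := by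
      apply Nat.le_floor
      rw [le_div_iff₀ hs]
      linarith
    have : d * (i + 1) ≤ d * j := Nat.mul_le_mul_left _ hij
    rw [mul_add] at this
    omega
  · obtain ⟨e, rfl⟩ := Nat.exists_eq_add_of_le hij
    have he : (e : ℚ) * (d * s) ≤ e * l := mul_le_mul_of_nonneg_left hds (by positivity)
    push_cast at h1
    have : ((m + d * e : ℕ) : ℚ) * s < ((m' + 1 : ℕ) : ℚ) * s := by
      push_cast
      nlinarith
    have h5 := lt_of_mul_lt_mul_right this hs.le
    have h6 : m + d * e < m' + 1 := by exact_mod_cast h5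
    rw [mul_add]
    omega

theorem bival_sum (M S : Finset α) (v : α → ℚ) (s l x y : ℚ) (hsl : s < l)
    (hbi : ∀ c ∈ M, v c = s ∨ v c = l) (hS : S ⊆ M) :
    ∑ c ∈ S, (if v c = l then x else y)
      = ((S.filter fun c => v c = l).card : ℚ) * x + ((S.filter fun c => ¬ v c = l).card : ℚ) * y := by
  rw [Finset.sum_ite]
  simp

theorem core_bival (n : ℕ) (M : Finset α) (A B : ℕ → Finset α) (c : α) (v : α → ℚ) (τ s l : ℚ)
    (hs : 0 < s) (hsl : s < l) (hbi : ∀ c ∈ M, v c = s ∨ v c = l)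
    (hc : c ∈ M) (hcs : v c = s)
    (hAM : ∀ k < n, A k ⊆ M) (hcov : ∀ x ∈ M, ∃ k < n, x ∈ A k)
    (hAτ : ∀ k < n, ∑ x ∈ A k, v x ≤ τ)
    (hA : ∀ k t, k < t → t < n → ∀ x ∈ A t, τ < ∑ y ∈ A k with v x ≤ v y, v y + v x)
    (hBM : ∀ k < n, B k ⊆ M) (hdis : ∀ k t, k < t → t < n → Disjoint (B k) (B t))
    (hcB : ∀ k < n, c ∉ B k)
    (hB : ∀ k < n, τ < ∑ x ∈ B k with v c ≤ v x, v x + v c)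
    (hB' : ∀ k t, k < t → t < n → ∀ x ∈ B t, τ < ∑ y ∈ B k with v x ≤ v y, v y + v x) :
    False := by
  have hl : 0 < l := hs.trans hsl
  have hsum : ∀ S ⊆ M, ∑ x ∈ S, v x
      = ((S.filter fun c => v c = l).card : ℚ) * l
        + ((S.filter fun c => ¬ v c = l).card : ℚ) * s := by
    intro S hS
    rw [← bival_sum M S v s l l s hsl hbi hS]
    apply Finset.sum_congr rfl
    intro x hx
    rcases hbi x (hS hx) with h | h
    · rw [if_neg (by rw [h]; exact hsl.ne), h]
    · rw [if_pos h, h]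
  have hlarge : ∀ S ⊆ M, ∑ x ∈ S with l ≤ v x, v x
      = ((S.filter fun c => v c = l).card : ℚ) * l := by
    intro S hS
    have : (S.filter fun x => l ≤ v x) = S.filter fun x => v x = l := by
      apply Finset.filter_congr
      intro x hx
      rcases hbi x (hS hx) with h | h
      · rw [h]; constructor
        · intro h'; linarith
        · intro h'; linarith
      · simp [h]
    rw [this, Finset.sum_congr rfl (g := fun _ => l)]
    · simp
    · intro x hx
      exact (Finset.mem_filter.1 hx).2
  obtain ⟨k, hk, hlt⟩ := exists_weight_lt n M A B c (fun x => if v x = l then (⌊l / s⌋₊ : ℚ) else 1)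
    (fun x hx => by
      split_ifs
      · positivity
      · norm_num) hc (by
      rw [if_neg (by rw [hcs]; exact hsl.ne)]; norm_num) hAM hcov hBM hdis hcB
  rw [bival_sum M _ v s l _ _ hsl hbi (hBM k hk), bival_sum M _ v s l _ _ hsl hbi (hAM k hk)] at hlt
  have hBk : τ < ∑ x ∈ B k, v x + s := by
    have := hB k hk
    rwa [hcs, Finset.filter_true_of_mem] at this
    intro x hx
    rcases hbi x (hBM k hk hx) with h | h
    · exact h.ge
    · rw [h]; exact hsl.le
  rw [hsum _ (hBM k hk)] at hBk
  have hAk := hAτ k hk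
  rw [hsum _ (hAM k hk)] at hAk
  have key := bival_pointwise s l τ hs hsl _ _ _ _ hAk hBk ?_
  · have key' : ((_ : ℕ) : ℚ) ≤ ((_ : ℕ) : ℚ) := Nat.cast_le.2 key
    push_cast at key'
    linarith
  · intro hij
    by_contra! hle
    -- the number of large chores in bin `t`
    set a : ℕ → ℕ := fun t => ((A t).filter fun c => v c = l).card with ha
    set b : ℕ → ℕ := fun t => ((B t).filter fun c => v c = l).card with hb
    change a k < b k at hij
    change ((a k : ℚ) + 1) * l ≤ τ at hle
    have hA0 : ∀ t, k < t → t < n → (A t).filter (fun c => v c = l) = ∅ := by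
      intro t hkt htn
      rw [Finset.filter_eq_empty_iff]
      intro x hx hxl
      have := hA k t hkt htn x hx
      rw [hxl, hlarge _ (hAM k hk)] at this
      change τ < (a k : ℚ) * l + l at this
      linarith
    have hap : ∀ t < n, a t ≤ ⌊τ / l⌋₊ := by
      intro t ht
      apply Nat.le_floor
      rw [le_div_iff₀ hl]
      have h1 := hAτ t ht
      rw [hsum _ (hAM t ht)] at h1
      have : (0 : ℚ) ≤ (((A t).filter fun c => ¬ v c = l).card : ℚ) * s := by positivity
      change (a t : ℚ) * l + _ ≤ τ at h1
      linarith
    have hbp : ∀ t < k, ⌊τ / l⌋₊ ≤ b t := by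
      intro t ht
      have hne : ((B k).filter fun c => v c = l).Nonempty := by
        rw [← Finset.card_pos]
        change 0 < b k
        omega
      obtain ⟨x, hx⟩ := hne
      rw [Finset.mem_filter] at hx
      have := hB' t k ht hk x hx.1
      rw [hx.2, hlarge _ (hBM t (ht.trans hk))] at this
      change τ < (b t : ℚ) * l + l at this
      apply Nat.le_of_lt_succ
      rcases le_or_gt 0 (τ / l) with h0 | h0
      · rw [Nat.floor_lt h0, div_lt_iff₀ hl]
        push_cast
        linarith
      · rw [Nat.floor_of_nonpos h0.le]
        omega
    have hM1 : (M.filter fun c => v c = l).card ≤ ∑ t ∈ range (k + 1), a t := by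
      refine le_trans (Finset.card_le_card ?_)
        (Finset.card_biUnion_le (s := range (k + 1)) (t := fun t => (A t).filter fun c => v c = l))
      intro x hx
      rw [Finset.mem_filter] at hx
      obtain ⟨t, ht, hxt⟩ := hcov x hx.1
      have hxt' : x ∈ (A t).filter fun c => v c = l := Finset.mem_filter.2 ⟨hxt, hx.2⟩
      refine Finset.mem_biUnion.2 ⟨t, ?_, hxt'⟩
      rw [mem_range]
      by_contra! hcon
      rw [hA0 t (by omega) ht] at hxt'
      simp at hxt'
    have hM2 : ∑ t ∈ range (k + 1), b t ≤ (M.filter fun c => v c = l).card := by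
      rw [hb, ← Finset.card_biUnion]
      · apply Finset.card_le_card
        intro x hx
        obtain ⟨t, ht, hxt⟩ := Finset.mem_biUnion.1 hx
        rw [mem_range] at ht
        rw [Finset.mem_filter] at hxt ⊢
        exact ⟨hBM t (by omega) hxt.1, hxt.2⟩
      · intro t ht u hu htu
        simp only [coe_range, Set.mem_Iio] at ht hu
        apply Finset.disjoint_filter_filter
        rcases lt_or_gt_of_ne htu with h' | h'
        · exact hdis t u h' (by omega)
        · exact (hdis u t h' (by omega)).symm
    rw [Finset.sum_range_succ] at hM1 hM2
    have : ∑ t ∈ range k, a t ≤ ∑ t ∈ range k, b t := by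
      apply Finset.sum_le_sum
      intro t ht
      rw [mem_range] at ht
      exact (hap t (by omega)).trans (hbp t ht)
    omega

/-- Invariant of the FFD bins. -/
def FFInv (v : α → ℚ) (τ : ℚ) (bins : List (Finset α)) : Prop :=
  (∀ A ∈ bins, ∑ x ∈ A, v x ≤ τ) ∧
    bins.Pairwise fun A A' => ∀ x ∈ A', τ < ∑ y ∈ A with v x ≤ v y, v y + v x

theorem ffdInsert_mem (v : α → ℚ) (τ : ℚ) (c : α) (bins : List (Finset α)) :
    ∀ A ∈ ffdInsert v τ c bins, ∀ x ∈ A, x = c ∨ ∃ A' ∈ bins, x ∈ A' := by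
  induction bins with
  | nil =>
    intro A hA x hx
    unfold ffdInsert at hA
    split_ifs at hA
    · simp at hA; subst hA; simp at hx; exact Or.inl hx
    · simp at hA
  | cons B rest ih =>
    intro A hA x hx
    unfold ffdInsert at hA
    split_ifs at hA
    · rcases List.mem_cons.1 hA with rfl | hA
      · rcases Finset.mem_insert.1 hx with h | h
        · exact Or.inl h
        · exact Or.inr ⟨B, by simp, h⟩
      · exact Or.inr ⟨A, by simp [hA], hx⟩
    · rcases List.mem_cons.1 hA with rfl | hA
      · exact Or.inr ⟨A, by simp, hx⟩
      · rcases ih A hA x hx with h | ⟨A', h, h'⟩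
        · exact Or.inl h
        · exact Or.inr ⟨A', by simp [h], h'⟩

theorem ffdInsert_inv (v : α → ℚ) (τ : ℚ) (c : α) (bins : List (Finset α))
    (h : FFInv v τ bins) (hle : ∀ A ∈ bins, ∀ x ∈ A, v c ≤ v x)
    (hnew : ∀ A ∈ bins, c ∉ A) (hpos : 0 ≤ v c) : FFInv v τ (ffdInsert v τ c bins) := by
  induction bins with
  | nil =>
    unfold ffdInsert
    split_ifs with h1
    · constructor
      · simpa using h1
      · simp
    · exact h
  | cons B rest ih =>
    obtain ⟨h1, h2⟩ := h
    rw [List.pairwise_cons] at h2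
    unfold ffdInsert
    split_ifs with hfit
    · refine ⟨?_, List.pairwise_cons.2 ⟨?_, h2.2⟩⟩
      · intro A hA
        rcases List.mem_cons.1 hA with rfl | hA
        · rw [Finset.sum_insert (hnew B (by simp))]
          unfold bundleCost at hfit
          linarith
        · exact h1 A (by simp [hA])
      · intro A' hA' x hx
        refine lt_of_lt_of_le (h2.1 A' hA' x hx) ?_
        have : ∑ y ∈ B with v x ≤ v y, v y ≤ ∑ y ∈ insert c B with v x ≤ v y, v y := by
          apply Finset.sum_le_sum_of_subset_of_nonneg
          · exact Finset.filter_subset_filter _ (Finset.subset_insert _ _)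
          · intro y hy hy'
            rw [Finset.mem_filter, Finset.mem_insert] at hy
            rw [Finset.mem_filter] at hy'
            rcases hy.1 with rfl | hyB
            · exact hpos
            · exact absurd ⟨hyB, hy.2⟩ hy'
        linarith
    · have ih' := ih ⟨fun A hA => h1 A (by simp [hA]), h2.2⟩
        (fun A hA => hle A (by simp [hA])) (fun A hA => hnew A (by simp [hA]))
      refine ⟨?_, List.pairwise_cons.2 ⟨?_, ih'.2⟩⟩
      · intro A hA
        rcases List.mem_cons.1 hA with rfl | hA
        · exact h1 A (by simp)
        · exact ih'.1 A hA
      · intro A' hA' x hx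
        rcases ffdInsert_mem v τ c rest A' hA' x hx with rfl | ⟨A'', hA'', hx'⟩
        · rw [Finset.filter_true_of_mem (hle B (by simp))]
          unfold bundleCost at hfit
          linarith
        · exact h2.1 A'' hA'' x hx'

theorem ffdFold_inv (v : α → ℚ) (τ : ℚ) (L : List α) : ∀ (bins : List (Finset α)),
    FFInv v τ bins → L.Nodup → L.Pairwise (fun c c' => v c' ≤ v c) →
    (∀ c ∈ L, ∀ A ∈ bins, ∀ x ∈ A, v c ≤ v x) → (∀ c ∈ L, ∀ A ∈ bins, c ∉ A) →
    (∀ c ∈ L, 0 ≤ v c) →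
    FFInv v τ (L.foldl (fun bins c => ffdInsert v τ c bins) bins) ∧
      ∀ A ∈ L.foldl (fun bins c => ffdInsert v τ c bins) bins, ∀ x ∈ A,
        x ∈ L ∨ ∃ A' ∈ bins, x ∈ A' := by
  induction L with
  | nil =>
    intro bins h _ _ _ _ _
    exact ⟨h, fun A hA x hx => Or.inr ⟨A, hA, hx⟩⟩
  | cons c L ih =>
    intro bins h hnd hpw hle hnew hpos
    rw [List.nodup_cons] at hnd
    rw [List.pairwise_cons] at hpw
    have := ih (ffdInsert v τ c bins)
      (ffdInsert_inv v τ c bins h (hle c (by simp)) (hnew c (by simp)) (hpos c (by simp)))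
      hnd.2 hpw.2 ?_ ?_ (fun y hy => hpos y (by simp [hy]))
    · refine ⟨this.1, ?_⟩
      intro A hA x hx
      rcases this.2 A hA x hx with h' | ⟨A', hA', hx'⟩
      · exact Or.inl (by simp [h'])
      · rcases ffdInsert_mem v τ c bins A' hA' x hx' with rfl | h'
        · exact Or.inl (by simp)
        · exact Or.inr h'
    · intro y hy A hA x hx
      rcases ffdInsert_mem v τ c bins A hA x hx with rfl | ⟨A', hA', hx'⟩
      · exact hpw.1 y hy
      · exact hle y (by simp [hy]) A' hA' x hx'
    · intro y hy A hA hyA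
      rcases ffdInsert_mem v τ c bins A hA y hyA with rfl | ⟨A', hA', hx'⟩
      · exact hnd.1 hy
      · exact hnew y (by simp [hy]) A' hA' hx'

theorem hffdBundle_spec {n : ℕ} (v : Fin n → α → ℚ) (τ : Fin n → ℚ) (Ag : Finset (Fin n))
    (i : Fin n) (hi : i ∈ Ag) (R : List α) : ∀ (B : Finset α),
    R.Pairwise (fun c c' => v i c' ≤ v i c) →
    (∀ x ∈ B, ∀ y ∈ R, v i y ≤ v i x) → (∀ x ∈ R, 0 ≤ v i x) →
    B ⊆ hffdBundle v τ Ag R B ∧ (∀ x ∈ hffdBundle v τ Ag R B, x ∈ B ∨ x ∈ R) ∧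
      ∀ c ∈ R, c ∉ hffdBundle v τ Ag R B →
        τ i < ∑ x ∈ hffdBundle v τ Ag R B with v i c ≤ v i x, v i x + v i c := by
  induction R with
  | nil =>
    intro B _ _ _
    unfold hffdBundle
    exact ⟨subset_rfl, fun x hx => Or.inl hx, by simp⟩
  | cons c R ih =>
    intro B hpw hle hpos
    rw [List.pairwise_cons] at hpw
    unfold hffdBundle
    split_ifs with hfit
    · obtain ⟨h1, h2, h3⟩ := ih (insert c B) hpw.2 (by
        intro x hx y hy
        rcases Finset.mem_insert.1 hx with rfl | hx
        · exact hpw.1 y hy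
        · exact hle x hx y (by simp [hy])) (fun x hx => hpos x (by simp [hx]))
      refine ⟨(Finset.subset_insert _ _).trans h1, ?_, ?_⟩
      · intro x hx
        rcases h2 x hx with h | h
        · rcases Finset.mem_insert.1 h with rfl | h
          · exact Or.inr (by simp)
          · exact Or.inl h
        · exact Or.inr (by simp [h])
      · intro y hy hyn
        rcases List.mem_cons.1 hy with rfl | hy
        · exact absurd (h1 (Finset.mem_insert_self _ _)) hyn
        · exact h3 y hy hyn
    · obtain ⟨h1, h2, h3⟩ := ih B hpw.2 (fun x hx y hy => hle x hx y (by simp [hy]))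
        (fun x hx => hpos x (by simp [hx]))
      refine ⟨h1, ?_, ?_⟩
      · intro x hx
        rcases h2 x hx with h | h
        · exact Or.inl h
        · exact Or.inr (by simp [h])
      · intro y hy hyn
        rcases List.mem_cons.1 hy with rfl | hy
        · push Not at hfit
          have h4 := hfit i hi
          unfold bundleCost at h4
          rw [Finset.sum_insert (fun h => hyn (h1 h))] at h4
          have h5 : ∑ x ∈ B, v i x ≤ ∑ x ∈ hffdBundle v τ Ag R B with v i y ≤ v i x, v i x := by
            apply Finset.sum_le_sum_of_subset_of_nonneg
            · intro x hx
              exact Finset.mem_filter.2 ⟨h1 hx, hle x hx y (by simp)⟩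
            · intro x hx hxB
              rcases h2 x (Finset.mem_filter.1 hx).1 with h | h
              · exact absurd h hxB
              · exact hpos x (by simp [h])
          linarith
        · exact h3 y hy hyn

theorem hffdState_anti {n : ℕ} (v : Fin n → α → ℚ) (τ : Fin n → ℚ)
    (L : List α) (σ : ℕ → Fin n) {k t : ℕ} (h : k ≤ t) :
    (hffdState v τ L σ t).1.Sublist (hffdState v τ L σ k).1 ∧
      (hffdState v τ L σ t).2 ⊆ (hffdState v τ L σ k).2 := by
  induction t, h using Nat.le_induction with
  | base => exact ⟨List.Sublist.refl _, subset_rfl⟩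
  | succ t _ ih =>
    refine ⟨List.Sublist.trans ?_ ih.1, subset_trans ?_ ih.2⟩
    · exact List.filter_sublist
    · exact Finset.erase_subset _ _

/-- on an IDO instance where all cost functions are factored, or all are
bivalued, if FFD succeeds into `n` bins for each agent `i` with threshold `τ i`, then HFFD
with thresholds `(τ 1, …, τ n)` allocates all chores, and each agent `i` receives a bundle
of `v i`-cost at most `τ i`. -/
theorem hffd_succeeds_of_ffd_per_agent
    (n : ℕ) (M : Finset α) (v : Fin n → α → ℚ)
    (hv : ∀ i, ∀ c ∈ M, 0 < v i c)
    (L : List α) (hL : IsUniversalOrder v M L)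
    (hval : (∀ i, Factored (v i) M) ∨ (∀ i, ∃ s l : ℚ, Bivalued (v i) M s l))
    (τ : Fin n → ℚ) (hτ : ∀ i, 0 < τ i)
    (hffd : ∀ i, FFDAllocatesInto (v i) (τ i) L n)
    (σ : ℕ → Fin n) (hσ : ValidHFFDRun v τ L σ) :
    (hffdState v τ L σ n).1 = [] ∧
      ∀ k < n, bundleCost (v (σ k)) (hffdBundleAt v τ L σ k) ≤ τ (σ k) := by
  refine ⟨?_, fun k hk => (hσ k hk).2⟩
  obtain ⟨hLM, hnd, hsort⟩ := hL
  have hmem : ∀ x, x ∈ L ↔ x ∈ M := fun x => by rw [← hLM, List.mem_toFinset]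
  have hn : 0 < n := (Nat.zero_le _).trans_lt (σ 0).isLt
  rw [List.eq_nil_iff_forall_not_mem]
  intro c hcR
  set w := σ (n - 1) with hw
  have hwAg : ∀ k < n, w ∈ (hffdState v τ L σ k).2 := fun k hk =>
    (hffdState_anti v τ L σ (show k ≤ n - 1 by omega)).2 (hσ (n - 1) (by omega)).1
  have hsub : ∀ k, (hffdState v τ L σ k).1.Sublist L := fun k =>
    (hffdState_anti v τ L σ (Nat.zero_le k)).1
  have hstep : ∀ k x, x ∈ (hffdState v τ L σ (k + 1)).1 →
      x ∈ (hffdState v τ L σ k).1 ∧ x ∉ hffdBundleAt v τ L σ k := by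
    intro k x hx
    simpa [hffdState, hffdBundleAt] using hx
  have hspec : ∀ k < n, (∀ x ∈ hffdBundleAt v τ L σ k, x ∈ (hffdState v τ L σ k).1) ∧
      ∀ x ∈ (hffdState v τ L σ (k + 1)).1,
        τ w < ∑ y ∈ hffdBundleAt v τ L σ k with v w x ≤ v w y, v w y + v w x := by
    intro k hk
    obtain ⟨-, h2, h3⟩ := hffdBundle_spec v τ (hffdState v τ L σ k).2 w (hwAg k hk)
      (hffdState v τ L σ k).1 ∅ ((hsort w).sublist (hsub k)) (by simp)
      (fun x hx => (hv w x ((hmem x).1 ((hsub k).subset hx))).le)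
    constructor
    · intro x hx
      rcases h2 x hx with h | h
      · simp at h
      · exact h
    · intro x hx
      exact h3 x (hstep k x hx).1 (hstep k x hx).2
  have hlater : ∀ k t, k < t → t < n → ∀ x ∈ hffdBundleAt v τ L σ t,
      x ∈ (hffdState v τ L σ (k + 1)).1 := fun k t hkt ht x hx =>
    (hffdState_anti v τ L σ (show k + 1 ≤ t from hkt)).1.subset ((hspec t ht).1 x hx)
  have hcl : ∀ k < n, c ∈ (hffdState v τ L σ (k + 1)).1 := fun k hk =>
    (hffdState_anti v τ L σ (show k + 1 ≤ n from hk)).1.subset hcR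
  have hcM : c ∈ M := (hmem c).1 ((hsub n).subset hcR)
  -- FFD side
  obtain ⟨hlen, hcov⟩ := hffd w
  have hinv := ffdFold_inv (v w) (τ w) L [] ⟨by simp, by simp⟩ hnd (hsort w) (by simp) (by simp)
    (fun x hx => (hv w x ((hmem x).1 hx)).le)
  change FFInv (v w) (τ w) (ffdBins (v w) (τ w) L) ∧
    ∀ A ∈ ffdBins (v w) (τ w) L, _ at hinv
  generalize ffdBins (v w) (τ w) L = bins at hlen hcov hinv
  obtain ⟨⟨hcost, hpw⟩, hbm⟩ := hinv
  let A : ℕ → Finset α := fun k => bins.getD k ∅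
  have hAcase : ∀ k, A k ∈ bins ∨ A k = ∅ := by
    intro k
    rcases lt_or_ge k bins.length with h | h
    · left
      simp [A, List.getD_eq_getElem?_getD, h]
    · right
      simp [A, List.getD_eq_getElem?_getD, h]
  have hAM : ∀ k < n, A k ⊆ M := by
    intro k _ x hx
    rcases hAcase k with h | h
    · rcases hbm _ h x hx with h' | h'
      · exact (hmem x).1 h'
      · simp at h'
    · rw [h] at hx; simp at hx
  have hAcov : ∀ x ∈ M, ∃ k < n, x ∈ A k := by
    intro x hx
    obtain ⟨B, hB, hxB⟩ := hcov x ((hmem x).2 hx)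
    obtain ⟨k, hk, rfl⟩ := List.getElem_of_mem hB
    exact ⟨k, by omega, by simpa [A, List.getD_eq_getElem?_getD, hk] using hxB⟩
  have hAτ : ∀ k < n, ∑ x ∈ A k, v w x ≤ τ w := by
    intro k _
    rcases hAcase k with h | h
    · exact hcost _ h
    · rw [h]; simpa using (hτ w).le
  have hAff : ∀ k t, k < t → t < n → ∀ x ∈ A t,
      τ w < ∑ y ∈ A k with v w x ≤ v w y, v w y + v w x := by
    intro k t hkt _ x hx
    rcases lt_or_ge t bins.length with h | h
    · have hk : k < bins.length := hkt.trans h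
      have h1 := List.pairwise_iff_getElem.1 hpw k t hk h hkt x
        (by simpa [A, List.getD_eq_getElem?_getD, h] using hx)
      simpa [A, List.getD_eq_getElem?_getD, hk] using h1
    · simp [A, List.getD_eq_getElem?_getD, h] at hx
  have hBM : ∀ k < n, hffdBundleAt v τ L σ k ⊆ M := fun k hk x hx =>
    (hmem x).1 ((hsub k).subset ((hspec k hk).1 x hx))
  have hdis : ∀ k t, k < t → t < n →
      Disjoint (hffdBundleAt v τ L σ k) (hffdBundleAt v τ L σ t) := by
    intro k t hkt ht
    rw [Finset.disjoint_right]
    intro x hx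
    exact (hstep k x (hlater k t hkt ht x hx)).2
  have hcB : ∀ k < n, c ∉ hffdBundleAt v τ L σ k := fun k hk => (hstep k c (hcl k hk)).2
  have hB : ∀ k < n, τ w < ∑ x ∈ hffdBundleAt v τ L σ k with v w c ≤ v w x, v w x + v w c :=
    fun k hk => (hspec k hk).2 c (hcl k hk)
  have hB' : ∀ k t, k < t → t < n → ∀ x ∈ hffdBundleAt v τ L σ t,
      τ w < ∑ y ∈ hffdBundleAt v τ L σ k with v w x ≤ v w y, v w y + v w x :=
    fun k t hkt ht x hx => (hspec k (hkt.trans ht)).2 x (hlater k t hkt ht x hx)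
  have hmulti := core_multiple n M A (hffdBundleAt v τ L σ) c (v w) (τ w) (hv w) hcM hAM hAcov hAτ
    hBM hdis hcB hB
  rcases hval with hF | hbv
  · apply hmulti
    intro x hx hle
    obtain ⟨q, -, hq⟩ := hF w c hcM x hx hle
    exact ⟨q, hq⟩
  · obtain ⟨s, l, hs, hsl, hbi⟩ := hbv w
    rcases hbi c hcM with hcs | hcl'
    · exact core_bival n M A (hffdBundleAt v τ L σ) c (v w) (τ w) s l hs hsl hbi hcM hcs hAM hAcov
        hAτ hAff hBM hdis hcB hB hB'
    · apply hmulti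
      intro x hx hle
      refine ⟨1, ?_⟩
      rcases hbi x hx with h | h
      · rw [h, hcl'] at hle
        linarith
      · rw [h, hcl']; simp
end

section
/- Let v be a factored cost function on a finite set M of chores, let n be a positive integer, and let μ = MMS^n(v, M) be the minimum makespan, i.e., the minimum over all partitions of M into n bundles of the maximum bundle cost. Then FFD(M, v, μ) allocates all chores into at most n bins. -/
open Finset

variable {α : Type*} [DecidableEq α]

/-- `P` is a partition of `M` into `d` (possibly empty) bundles. -/
def IsPartitionInto (M : Finset α) (d : ℕ) (P : Fin d → Finset α) : Prop :=
  (∀ j, P j ⊆ M) ∧ (∀ j k, j ≠ k → Disjoint (P j) (P k)) ∧ ∀ c ∈ M, ∃ j, c ∈ P j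

/-- `μ` is the `d`-maximin share `MMS^d(v, M)`: the minimum, over all partitions of `M`
into `d` bundles, of the maximum bundle cost. -/
def IsMMS (v : α → ℚ) (M : Finset α) (d : ℕ) (μ : ℚ) : Prop :=
  (∃ P : Fin d → Finset α, IsPartitionInto M d P ∧ ∀ j, bundleCost v (P j) ≤ μ) ∧
    ∀ P : Fin d → Finset α, IsPartitionInto M d P → ∃ j, μ ≤ bundleCost v (P j)

lemma aux_len (v : α → ℚ) (τ : ℚ) (c : α) (bins : List (Finset α)) :
    (ffdInsert v τ c bins).length ≤ bins.length ∨
    ((ffdInsert v τ c bins).length = bins.length + 1 ∧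
      ∀ B ∈ bins, τ < bundleCost v B + v c) := by
  induction bins with
  | nil =>
    unfold ffdInsert
    split_ifs <;> simp
  | cons B rest ih =>
    unfold ffdInsert
    split_ifs with h
    · left; simp
    · rcases ih with ih | ⟨ih, h2⟩
      · left; simpa using ih
      · right
        refine ⟨by simp [ih], ?_⟩
        intro B' hB'
        rcases List.mem_cons.1 hB' with rfl | hB'
        · exact not_le.1 h
        · exact h2 _ hB'

lemma aux_mem (v : α → ℚ) (τ : ℚ) (c : α) (hc : v c ≤ τ) (bins : List (Finset α)) (x : α) :
    (∃ B ∈ ffdInsert v τ c bins, x ∈ B) ↔ (x = c ∨ ∃ B ∈ bins, x ∈ B) := by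
  induction bins with
  | nil =>
    unfold ffdInsert
    simp [hc]
  | cons B rest ih =>
    unfold ffdInsert
    split_ifs with h
    · simp [or_assoc]
    · simp only [List.exists_mem_cons_iff, ih]
      tauto

lemma aux_sum (v : α → ℚ) (τ : ℚ) (c : α) (hc : v c ≤ τ) (bins : List (Finset α))
    (hn : ∀ B ∈ bins, c ∉ B) :
    ((ffdInsert v τ c bins).map (bundleCost v)).sum
      = (bins.map (bundleCost v)).sum + v c := by
  induction bins with
  | nil =>
    unfold ffdInsert
    simp [hc, bundleCost]
  | cons B rest ih =>
    have ih := ih (fun B hB => hn B (List.mem_cons_of_mem _ hB))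
    have hB := hn B List.mem_cons_self
    unfold ffdInsert
    split_ifs with h
    · simp only [List.map_cons, List.sum_cons]
      have : bundleCost v (insert c B) = v c + bundleCost v B := by
        unfold bundleCost; exact Finset.sum_insert hB
      rw [this]; ring
    · simp only [List.map_cons, List.sum_cons, ih]; ring

lemma aux_mult (v : α → ℚ) (w : ℚ) (S : Finset α)
    (h : ∀ x ∈ S, ∃ q : ℕ, v x = q * w) : ∃ q : ℕ, bundleCost v S = q * w := by
  choose! q hq using h
  refine ⟨∑ x ∈ S, q x, ?_⟩
  unfold bundleCost
  rw [Finset.sum_congr rfl hq]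
  push_cast
  rw [Finset.sum_mul]

lemma aux_contra (v : α → ℚ) (μ w : ℚ) (hw : 0 < w) (n : ℕ) (P : Fin n → Finset α)
    (T : Finset α) (hdisj : ∀ j k, j ≠ k → Disjoint (P j) (P k))
    (hcov : ∀ c ∈ T, ∃ j, c ∈ P j) (hPμ : ∀ j, bundleCost v (P j ∩ T) ≤ μ)
    (hT : ∀ x ∈ T, ∃ q : ℕ, v x = q * w)
    (bins : List (Finset α)) (hlen : n ≤ bins.length) (hsub : ∀ B ∈ bins, B ⊆ T)
    (hμ : 0 ≤ μ)
    (hfull : ∀ B ∈ bins, μ < bundleCost v B + w)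
    (hsum : (bins.map (bundleCost v)).sum + w = bundleCost v T) : False := by
  have h1 : ∀ j, bundleCost v (P j ∩ T) ≤ ⌊μ / w⌋ * w := by
    intro j
    obtain ⟨q, hq⟩ := aux_mult v w (P j ∩ T) (fun x hx => hT x (Finset.mem_inter.1 hx).2)
    have := hPμ j
    rw [hq] at this ⊢
    have h2 : (q : ℤ) ≤ ⌊μ / w⌋ := by
      rw [Int.le_floor, le_div_iff₀ hw]; exact_mod_cast this
    have h3 : (q : ℚ) ≤ ⌊μ / w⌋ := by exact_mod_cast h2
    exact mul_le_mul_of_nonneg_right h3 hw.le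
  have h2 : ∀ y ∈ bins.map (bundleCost v), (⌊μ / w⌋ * w : ℚ) ≤ y := by
    intro y hy
    obtain ⟨B, hB, rfl⟩ := List.mem_map.1 hy
    obtain ⟨q, hq⟩ := aux_mult v w B (fun x hx => hT x (hsub B hB hx))
    have := hfull B hB
    rw [hq] at this ⊢
    have h2 : ⌊μ / w⌋ < (q : ℤ) + 1 := by
      rw [Int.floor_lt, div_lt_iff₀ hw]; push_cast; linarith
    have h3 : (⌊μ / w⌋ : ℚ) ≤ q := by exact_mod_cast Int.lt_add_one_iff.1 h2
    exact mul_le_mul_of_nonneg_right h3 hw.le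
  have h3 := List.card_nsmul_le_sum _ _ h2
  have h4 : bundleCost v T = ∑ j, bundleCost v (P j ∩ T) := by
    have : T = Finset.univ.biUnion (fun j => P j ∩ T) := by
      ext x
      simp only [Finset.mem_biUnion, Finset.mem_univ, true_and, Finset.mem_inter]
      exact ⟨fun hx => (hcov x hx).imp fun j hj => ⟨hj, hx⟩, fun ⟨j, hj⟩ => hj.2⟩
    unfold bundleCost
    conv_lhs => rw [this]
    apply Finset.sum_biUnion
    intro i _ j _ hij
    exact (hdisj i j hij).mono Finset.inter_subset_left Finset.inter_subset_left
  have h5 : ∑ j, bundleCost v (P j ∩ T) ≤ n * (⌊μ / w⌋ * w) := by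
    have := Finset.sum_le_card_nsmul Finset.univ _ _ (fun j _ => h1 j)
    simpa using this
  have h0 : (0 : ℚ) ≤ ⌊μ / w⌋ * w := by
    have : 0 ≤ ⌊μ / w⌋ := Int.floor_nonneg.2 (div_nonneg hμ hw.le)
    have : (0 : ℚ) ≤ ⌊μ / w⌋ := by exact_mod_cast this
    positivity
  have h6 : (n : ℚ) * (⌊μ / w⌋ * w) ≤ bins.length * (⌊μ / w⌋ * w) :=
    mul_le_mul_of_nonneg_right (by exact_mod_cast hlen) h0
  simp only [List.length_map, nsmul_eq_mul] at h3
  linarith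

lemma aux_inv (M : Finset α) (v : α → ℚ) (hv : ∀ c ∈ M, 0 < v c)
    (hfac : Factored v M) (n : ℕ) (μ : ℚ) (P : Fin n → Finset α)
    (hP : IsPartitionInto M n P) (hPμ : ∀ j, bundleCost v (P j) ≤ μ) (L : List α) :
    L.toFinset ⊆ M → L.Nodup → (L.Pairwise fun c c' => v c' ≤ v c) →
    (ffdBins v μ L).length ≤ n ∧
    (∀ x, (∃ B ∈ ffdBins v μ L, x ∈ B) ↔ x ∈ L) ∧
    ((ffdBins v μ L).map (bundleCost v)).sum = bundleCost v L.toFinset := by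
  induction L using List.reverseRecOn with
  | nil => intro _ _ _; simp [ffdBins, bundleCost]
  | append_singleton L c ih =>
    intro hM hnd hpw
    have hcM : c ∈ M := hM (by simp)
    have hLM : L.toFinset ⊆ M := fun x hx => hM (by simp at hx ⊢; tauto)
    rw [List.pairwise_append] at hpw
    have hcL : c ∉ L := by
      intro h
      exact (List.disjoint_of_nodup_append hnd) h (by simp)
    obtain ⟨i1, i2, i3⟩ := ih hLM (List.Nodup.of_append_left hnd) hpw.1
    have hstep : ffdBins v μ (L ++ [c]) = ffdInsert v μ c (ffdBins v μ L) := by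
      simp [ffdBins, List.foldl_append]
    have hsubcost : ∀ j, ∀ S ⊆ P j, bundleCost v S ≤ μ := by
      intro j S hS
      refine le_trans ?_ (hPμ j)
      exact Finset.sum_le_sum_of_subset_of_nonneg hS
        (fun x hx _ => (hv x (hP.1 j hx)).le)
    have hcμ : v c ≤ μ := by
      obtain ⟨j, hj⟩ := hP.2.2 c hcM
      have := hsubcost j {c} (by simpa using hj)
      simpa [bundleCost] using this
    have hnot : ∀ B ∈ ffdBins v μ L, c ∉ B := fun B hB hcB => hcL ((i2 c).1 ⟨B, hB, hcB⟩)
    have hT : (L ++ [c]).toFinset = insert c L.toFinset := by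
      ext x; simp [or_comm]
    have hsum : bundleCost v (L ++ [c]).toFinset = bundleCost v L.toFinset + v c := by
      rw [hT]; unfold bundleCost
      rw [Finset.sum_insert (by simpa using hcL)]; ring
    rw [hstep]
    refine ⟨?_, ?_, ?_⟩
    · rcases aux_len v μ c (ffdBins v μ L) with h | ⟨h, hfull⟩
      · exact h.trans i1
      · by_contra hcon
        refine aux_contra v μ (v c) (hv c hcM) n P (L ++ [c]).toFinset hP.2.1
          (fun x hx => hP.2.2 x (hM hx)) (fun j => hsubcost j _ Finset.inter_subset_left) ?_
          (ffdBins v μ L) (by omega) ?_ ((hv c hcM).le.trans hcμ) hfull (by rw [hsum, i3])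
        · intro x hx
          have hle : v c ≤ v x := by
            rcases List.mem_append.1 (List.mem_toFinset.1 hx) with h | h
            · exact hpw.2.2 x h c (by simp)
            · rw [List.mem_singleton.1 h]
          obtain ⟨q, _, hq⟩ := hfac c hcM x (hM hx) hle
          exact ⟨q, hq⟩
        · intro B hB x hx
          have := (i2 x).1 ⟨B, hB, hx⟩
          simp [this]
    · intro x
      rw [aux_mem v μ c hcμ, i2]
      simp [or_comm]
    · rw [aux_sum v μ c hcμ _ hnot, i3, hsum]

/-- for a factored cost function, FFD with threshold equal to the minimum
makespan `μ = MMS^n(v, M)` allocates all chores into at most `n` bins. -/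
theorem ffd_factored_at_mms
    (M : Finset α) (v : α → ℚ) (hv : ∀ c ∈ M, 0 < v c)
    (hfac : Factored v M) (n : ℕ) (hn : 0 < n)
    (μ : ℚ) (hμ : IsMMS v M n μ)
    (L : List α) (hL : IsFFDList v M L) :
    FFDAllocatesInto v μ L n := by
  obtain ⟨⟨P, hP, hPμ⟩, _⟩ := hμ
  obtain ⟨h1, h2, _⟩ := aux_inv M v hv hfac n μ P hP hPμ L hL.1.le hL.2.1 hL.2.2
  exact ⟨h1, fun c hc => (h2 c).2 hc⟩
end
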